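/- Every hyperbolic group embeds into a full, contracting rational similarity group: for every hyperbolic group G there exist a finite directed graph Γ whose subshift Σ_Γ has no isolated points or empty cones, a nonempty clopen set E ⊆ Σ_Γ, a subgroup H ≤ R_{Γ,E} that is a contracting RSG and is full as a group of homeomorphisms of E, and an injective group homomorphism G → H. -/

import Mathlib

open scoped Classical

noncomputable section

/-- The word length of `g` with respect to a generating set `S` (using letters from
`S ∪ S⁻¹`). -/
def wordLength {G : Type} [Group G] (S : Set G) (g : G) : ℕ :=
  sInf {n | ∃ l : List G, l.length = n ∧ (∀ x ∈ l, x ∈ S ∨ x⁻¹ ∈ S) ∧ l.prod = g}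

/-- The word metric on `G` with respect to `S`. -/
def wordDist {G : Type} [Group G] (S : Set G) (x y : G) : ℕ :=
  wordLength S (x⁻¹ * y)

/-- `p 0, p 1, …, p n` is a geodesic segment for the word metric. -/
def IsGeodesicSeg {G : Type} [Group G] (S : Set G) (p : ℕ → G) (n : ℕ) : Prop :=
  ∀ i j : ℕ, i ≤ j → j ≤ n → wordDist S (p i) (p j) = j - i

/-- The Cayley graph of `G` with respect to `S` is `δ`-hyperbolic: every side of every
geodesic triangle lies in the `δ`-neighborhood of the union of the other two sides. -/
def SlimTriangles {G : Type} [Group G] (S : Set G) (δ : ℝ) : Prop :=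
  ∀ (p q r : ℕ → G) (np nq nr : ℕ),
    IsGeodesicSeg S p np → IsGeodesicSeg S q nq → IsGeodesicSeg S r nr →
    p np = q 0 → q nq = r 0 → r nr = p 0 →
    ∀ i ≤ np, ∃ j : ℕ,
      (j ≤ nq ∧ (wordDist S (p i) (q j) : ℝ) ≤ δ) ∨
      (j ≤ nr ∧ (wordDist S (p i) (r j) : ℝ) ≤ δ)

/-- A group is hyperbolic if it has a finite generating set whose Cayley graph is
`δ`-hyperbolic for some `δ > 0`. -/
def IsHyperbolicGroup (G : Type) [Group G] : Prop :=
  ∃ S : Set G, S.Finite ∧ Subgroup.closure S = ⊤ ∧ ∃ δ : ℝ, 0 < δ ∧ SlimTriangles S δ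

/-- The ball of radius `n` about the identity. -/
def ball {G : Type} [Group G] (S : Set G) (n : ℕ) : Set G :=
  {x | wordLength S x ≤ n}

/-- `x ∼ y` for the ball `B_n`: the function `d_x - d_y` is constant on `B_n`. -/
def SameAtom {G : Type} [Group G] (S : Set G) (n : ℕ) (x y : G) : Prop :=
  ∀ a ∈ ball S n, ∀ b ∈ ball S n,
    (wordDist S x a : ℤ) - (wordDist S y a : ℤ) =
      (wordDist S x b : ℤ) - (wordDist S y b : ℤ)

/-- The atom for `B_n` containing `x`. -/
def atomOf {G : Type} [Group G] (S : Set G) (n : ℕ) (x : G) : Set G :=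
  {y | SameAtom S n x y}

/-- `𝒜_n(G)`: the infinite atoms for `B_n`. -/
def InfAtoms {G : Type} [Group G] (S : Set G) (n : ℕ) : Set (Set G) :=
  {A | (∃ x, A = atomOf S n x) ∧ A.Infinite}

/-- `g` is a morphism from the atom `A₁ ∈ 𝒜_m(G)` to the atom `A₂ ∈ 𝒜_n(G)`. -/
def IsMorphism {G : Type} [Group G] (S : Set G) (g : G) (m : ℕ) (A₁ : Set G)
    (n : ℕ) (A₂ : Set G) : Prop :=
  ((g * ·) '' A₁ = A₂) ∧
  (∀ k : ℕ, (g * ·) '' (A₁ ∩ ball S (m + k)) = A₂ ∩ ball S (n + k)) ∧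
  ∀ k : ℕ, 0 < k → ∀ A' ∈ InfAtoms S (m + k), A' ⊆ A₁ →
    (g * ·) '' A' ∈ InfAtoms S (n + k) ∧ (g * ·) '' A' ⊆ A₂

/-- Two atoms have the same type if there is a morphism between them. -/
def SameType {G : Type} [Group G] (S : Set G) (m : ℕ) (A₁ : Set G) (n : ℕ)
    (A₂ : Set G) : Prop :=
  ∃ g : G, IsMorphism S g m A₁ n A₂

/-- `N(A)`: the set of points of `B_n` at which `d̄_A` attains its minimum, i.e. the set
of nearest neighbors in `B_n` of the points of `A`. -/
def nearestSet {G : Type} [Group G] (S : Set G) (n : ℕ) (A : Set G) : Set G :=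
  {p | p ∈ ball S n ∧ ∀ x ∈ A, ∀ q ∈ ball S n, wordDist S x p ≤ wordDist S x q}
/-- A finite directed graph (loops and parallel edges are allowed). -/
structure FinDigraph : Type 1 where
  V : Type
  E : Type
  [fintypeV : Fintype V]
  [fintypeE : Fintype E]
  o : E → V
  t : E → V

attribute [instance] FinDigraph.fintypeV FinDigraph.fintypeE

instance (Γ : FinDigraph) : TopologicalSpace Γ.E := ⊥
instance (Γ : FinDigraph) : DiscreteTopology Γ.E := ⟨rfl⟩

namespace FinDigraph

variable (Γ : FinDigraph)

/-- The subshift of finite type `Σ_Γ`: the set of all infinite directed paths in `Γ`,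
viewed as a subset of the product space of all edge sequences (each edge's terminus is
the origin of the next edge). -/
def shift : Set (ℕ → Γ.E) := {x | ∀ i, Γ.t (x i) = Γ.o (x (i + 1))}

/-- Validity of a finite directed path starting at a given node. -/
def pathOk : Γ.V → List Γ.E → Prop
  | _, [] => True
  | v, e :: l => Γ.o e = v ∧ pathOk (Γ.t e) l

/-- A finite directed path in `Γ` (a node together with a compatible list of edges;
a path with no edges is a node, regarded as a path of length `0`). -/
structure FinPath where
  start : Γ.V
  edges : List Γ.E
  ok : Γ.pathOk start edges

/-- Terminus of a list of edges starting at a given node. -/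
def pathEndAux : Γ.V → List Γ.E → Γ.V
  | v, [] => v
  | _, e :: l => pathEndAux (Γ.t e) l

/-- The terminus `t(α)` of a finite directed path. -/
def pathEnd (α : Γ.FinPath) : Γ.V := Γ.pathEndAux α.start α.edges

/-- The length-0 path at a node `v`. -/
def trivPath (v : Γ.V) : Γ.FinPath := ⟨v, [], by simp [pathOk]⟩

/-- The cone `C_α ⊆ Σ_Γ` of all infinite directed paths having `α` as a prefix. -/
def cone (α : Γ.FinPath) : Set (ℕ → Γ.E) :=
  {x | x ∈ Γ.shift ∧ Γ.o (x 0) = α.start ∧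
    ∀ (i : ℕ) (h : i < α.edges.length), x i = α.edges.get ⟨i, h⟩}

/-- The canonical similarity `C_α → C_β` (for `t(α) = t(β)`) on the level of edge
sequences: delete the prefix `α` and attach the prefix `β`. -/
def splice (α β : Γ.FinPath) (x : ℕ → Γ.E) : ℕ → Γ.E := fun i =>
  if h : i < β.edges.length then β.edges.get ⟨i, h⟩
  else x (i - β.edges.length + α.edges.length)

/-- Concatenation `α · ω` of a finite path with an infinite path (on sequences). -/
def catPath (α : Γ.FinPath) (x : ℕ → Γ.E) : ℕ → Γ.E :=
  Γ.splice (Γ.trivPath (Γ.pathEnd α)) α x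

/-- The length of the path `f̄(α)`, i.e. of the greatest common prefix of all points
of `f(C_α)`. -/
def barLen (f : (ℕ → Γ.E) → ℕ → Γ.E) (α : Γ.FinPath) : ℕ :=
  sSup {n | ∀ x ∈ Γ.cone α, ∀ y ∈ Γ.cone α, ∀ i < n, f x i = f y i}

/-- The local action `f|_α : C_{t(α)} → C_{t(f̄(α))}`, determined by
`f(α·ω) = f̄(α)·(f|_α)(ω)`.  It is recorded together with the node `t(α)`
(the node of its domain cone), and is extended by the identity off the cone
`C_{t(α)}`. -/
def localAction (f : (ℕ → Γ.E) → ℕ → Γ.E) (α : Γ.FinPath) :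
    Γ.V × ((ℕ → Γ.E) → ℕ → Γ.E) :=
  (Γ.pathEnd α, fun w =>
    if w ∈ Γ.cone (Γ.trivPath (Γ.pathEnd α)) then
      fun i => f (Γ.catPath α w) (i + Γ.barLen f α)
    else w)

/-- A map is rational (on a domain `D`) if it has only finitely many distinct local
actions at cones contained in `D`. -/
def RationalOn (f : (ℕ → Γ.E) → ℕ → Γ.E) (D : Set (ℕ → Γ.E)) : Prop :=
  (Γ.localAction f '' {α : Γ.FinPath | Γ.cone α ⊆ D}).Finite

/-- The nucleus `𝒩_f` of a map: the set of local actions `f|_α` that occur for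
infinitely many finite paths `α` with `C_α` contained in the domain. -/
def nucleusOf (f : (ℕ → Γ.E) → ℕ → Γ.E) (D : Set (ℕ → Γ.E)) :
    Set (Γ.V × ((ℕ → Γ.E) → ℕ → Γ.E)) :=
  {p | {α : Γ.FinPath | Γ.cone α ⊆ D ∧ Γ.localAction f α = p}.Infinite}

/-- A nondegenerate map on `Σ_Γ` with domain `D`: it takes values in `Σ_Γ` and maps no
cone contained in `D` to a single point. -/
def Nondegenerate (f : (ℕ → Γ.E) → ℕ → Γ.E) (D : Set (ℕ → Γ.E)) : Prop :=
  (∀ x ∈ D, f x ∈ Γ.shift) ∧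
  ∀ α : Γ.FinPath, Γ.cone α ⊆ D → ¬∃ p, ∀ x ∈ Γ.cone α, f x = p

/-- Extension of a map `E → E'` between subsets of the sequence space to a globally
defined map (by the identity off `E`). -/
def homExt (E E' : Set (ℕ → Γ.E)) (f : ↥E → ↥E') : (ℕ → Γ.E) → ℕ → Γ.E :=
  fun x => if h : x ∈ E then ↑(f ⟨x, h⟩) else x

/-- Extension of a permutation of `E` to a globally defined map. -/
def permExt (E : Set (ℕ → Γ.E)) (g : Equiv.Perm ↥E) : (ℕ → Γ.E) → ℕ → Γ.E :=
  Γ.homExt E E ⇑g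

/-- `E` is a clopen subset of the subshift `Σ_Γ`. -/
def ClopenIn (E : Set (ℕ → Γ.E)) : Prop :=
  IsClopen {x : ↥Γ.shift | (x : ℕ → Γ.E) ∈ E}

/-- `U ⊆ Σ_Γ` is open in the subshift. -/
def OpenInShift (U : Set (ℕ → Γ.E)) : Prop :=
  IsOpen {x : ↥Γ.shift | (x : ℕ → Γ.E) ∈ U}

/-- The subshift `Σ_Γ` has no isolated points. -/
def NoIsolatedPoints : Prop := ∀ x : ↥Γ.shift, ¬IsOpen ({x} : Set ↥Γ.shift)

/-- The subshift `Σ_Γ` has no empty cones. -/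
def NoEmptyCones : Prop := ∀ α : Γ.FinPath, (Γ.cone α).Nonempty

/-- A permutation of `E` which is a homeomorphism and is a rational map:
an element of the rational group `R_{Γ,E}`. -/
def IsRatHomeo (E : Set (ℕ → Γ.E)) (g : Equiv.Perm ↥E) : Prop :=
  Continuous ⇑g ∧ Continuous ⇑g.symm ∧ Γ.RationalOn (Γ.permExt E g) E

/-- `g` maps the cone `C_α` to the cone `C_β` by the canonical similarity
`α·ω ↦ β·ω`. -/
def RealizesCanonSim (E : Set (ℕ → Γ.E)) (g : Equiv.Perm ↥E) (α β : Γ.FinPath) : Prop :=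
  ∀ x, ∀ hx : x ∈ E, x ∈ Γ.cone α → ↑(g ⟨x, hx⟩) = Γ.splice α β x

/-- A rational similarity group (RSG): a subgroup of the rational group `R_{Γ,E}` that
realizes the canonical similarity between any two cones `C_α, C_β ⊊ E` with
`t(α) = t(β)`. -/
def IsRSG (E : Set (ℕ → Γ.E)) (G : Subgroup (Equiv.Perm ↥E)) : Prop :=
  (∀ g ∈ G, Γ.IsRatHomeo E g) ∧
  ∀ α β : Γ.FinPath, Γ.pathEnd α = Γ.pathEnd β → Γ.cone α ⊂ E → Γ.cone β ⊂ E →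
    ∃ g ∈ G, Γ.RealizesCanonSim E g α β

/-- `h` locally agrees with the group `G`: every point has an open neighborhood on
which `h` coincides with some element of `G`. -/
def LocallyAgrees (E : Set (ℕ → Γ.E)) (G : Subgroup (Equiv.Perm ↥E))
    (h : Equiv.Perm ↥E) : Prop :=
  ∀ x : ↥E, ∃ U : Set ↥E, IsOpen U ∧ x ∈ U ∧ ∃ g ∈ G, ∀ u ∈ U, h u = g u

/-- `G` is full as a group of homeomorphisms of `E`: every homeomorphism of `E` that
locally agrees with `G` already belongs to `G`. -/
def IsFullOn (E : Set (ℕ → Γ.E)) (G : Subgroup (Equiv.Perm ↥E)) : Prop :=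
  ∀ h : Equiv.Perm ↥E, Continuous ⇑h → Continuous ⇑h.symm →
    Γ.LocallyAgrees E G h → h ∈ G

/-- The nucleus `𝒩_G` of a subgroup `G ≤ R_{Γ,E}`: the union of the nuclei of its
elements. -/
def groupNucleus (E : Set (ℕ → Γ.E)) (G : Subgroup (Equiv.Perm ↥E)) :
    Set (Γ.V × ((ℕ → Γ.E) → ℕ → Γ.E)) :=
  ⋃ g ∈ G, Γ.nucleusOf (Γ.permExt E g) E

/-- An edge of the induced subgraph on a set `W` of nodes. -/
def InducedEdge (W : Set Γ.V) (e : Γ.E) : Prop := Γ.o e ∈ W ∧ Γ.t e ∈ W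

/-- A path of the induced subgraph on `W`. -/
def PathIn (W : Set Γ.V) (α : Γ.FinPath) : Prop :=
  α.start ∈ W ∧ ∀ e ∈ α.edges, Γ.InducedEdge W e

/-- The induced subgraph on `W` is strongly connected and is not a directed cycle,
i.e. `Σ_{Γ₀}` is irreducible (where `Γ₀` is the induced subgraph on `W`). -/
def IrreducibleOn (W : Set Γ.V) : Prop :=
  (∀ v ∈ W, ∀ w ∈ W, ∃ α : Γ.FinPath,
      α.start = v ∧ Γ.pathEnd α = w ∧ α.edges ≠ [] ∧ Γ.PathIn W α) ∧
  ¬∀ v ∈ W, ∃! e : Γ.E, Γ.InducedEdge W e ∧ Γ.o e = v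

/-- `Σ_Γ` has an irreducible core: an induced subgraph `Γ₀` (on a node set `W`) with
`Σ_{Γ₀}` irreducible, such that every node has a directed path to `Γ₀` and every
sufficiently long directed path ends in `Γ₀`. -/
def HasIrreducibleCore : Prop :=
  ∃ W : Set Γ.V, Γ.IrreducibleOn W ∧
    (∀ v : Γ.V, ∃ α : Γ.FinPath, α.start = v ∧ Γ.pathEnd α ∈ W) ∧
    ∃ N : ℕ, ∀ α : Γ.FinPath, α.edges.length = N → Γ.pathEnd α ∈ W

/-- `G ≤ R_{Γ,E}` is contracting: `Σ_Γ` has an irreducible core and the nucleus `𝒩_G`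
is finite. -/
def IsContracting (E : Set (ℕ → Γ.E)) (G : Subgroup (Equiv.Perm ↥E)) : Prop :=
  Γ.HasIrreducibleCore ∧ (Γ.groupNucleus E G).Finite

/-- An element of the Thompson group `V_{Γ,E}`: there are partitions of `E` into cones
`C_{α_1},…,C_{α_k}` and `C_{β_1},…,C_{β_k}` with `t(α_i) = t(β_i)` such that `g` maps
each `C_{α_i}` to `C_{β_i}` by the canonical similarity. -/
def IsThompson (E : Set (ℕ → Γ.E)) (g : Equiv.Perm ↥E) : Prop :=
  ∃ (k : ℕ) (α β : Fin k → Γ.FinPath),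
    (∀ i, Γ.pathEnd (α i) = Γ.pathEnd (β i)) ∧
    E = (⋃ i, Γ.cone (α i)) ∧
    Pairwise (fun i j => Disjoint (Γ.cone (α i)) (Γ.cone (α j))) ∧
    E = (⋃ i, Γ.cone (β i)) ∧
    Pairwise (fun i j => Disjoint (Γ.cone (β i)) (Γ.cone (β j))) ∧
    ∀ i, Γ.RealizesCanonSim E g (α i) (β i)

/-- A rational (eventually repeating) point `σ·τ^∞` of `Σ_Γ`. -/
def IsRationalPt (x : ℕ → Γ.E) : Prop :=
  ∃ σ τ : Γ.FinPath, τ.edges ≠ [] ∧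
    (∀ (i : ℕ) (h : i < σ.edges.length), x i = σ.edges.get ⟨i, h⟩) ∧
    ∀ i : ℕ, σ.edges.length ≤ i →
      ∀ h : (i - σ.edges.length) % τ.edges.length < τ.edges.length,
        x i = τ.edges.get ⟨(i - σ.edges.length) % τ.edges.length, h⟩

/-- `β = f̄(α)`: the cone `C_β` is the smallest cone containing `f(C_α)`, with `β` the
greatest common prefix of the points of `f(C_α)`. -/
def IsBar (f : (ℕ → Γ.E) → ℕ → Γ.E) (α β : Γ.FinPath) : Prop :=
  f '' Γ.cone α ⊆ Γ.cone β ∧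
  ∀ γ : Γ.FinPath, f '' Γ.cone α ⊆ Γ.cone γ →
    Γ.cone β ⊆ Γ.cone γ ∧ γ.edges.length ≤ β.edges.length

end FinDigraph

namespace HypCode

theorem wordLength_le {G : Type} [Group G] {S : Set G} (l : List G)
    (hl : ∀ x ∈ l, x ∈ S ∨ x⁻¹ ∈ S) :
    wordLength S l.prod ≤ l.length :=
  Nat.sInf_le ⟨l, rfl, hl, rfl⟩

/-- A finite generating set of `G` with `δ`-slim triangles, `δ` a positive integer. -/
class Ctx (G : Type) [Group G] where
  S : Set G
  finS : S.Finite
  genS : Subgroup.closure S = ⊤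
  δ : ℕ
  δpos : 1 ≤ δ
  slim : SlimTriangles S (δ : ℝ)

variable {G : Type} [Group G] [Ctx G]

/-- The word distance of the fixed generating set. -/
def dst (x y : G) : ℕ := wordDist (Ctx.S (G := G)) x y

/-- The word length of the fixed generating set. -/
def len (x : G) : ℕ := dst 1 x

/-- `s` is a generator or the inverse of one. -/
def gen (s : G) : Prop := s ∈ Ctx.S (G := G) ∨ s⁻¹ ∈ Ctx.S (G := G)

theorem exists_list (g : G) :
    ∃ l : List G, (∀ x ∈ l, gen x) ∧ l.prod = g := by
  have hg : g ∈ Subgroup.closure (Ctx.S (G := G)) := by rw [Ctx.genS]; trivial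
  induction hg using Subgroup.closure_induction with
  | mem x hx => exact ⟨[x], by simp [gen, hx], by simp⟩
  | one => exact ⟨[], by simp, by simp⟩
  | mul x y _ _ hx hy =>
    obtain ⟨l, hl, rfl⟩ := hx
    obtain ⟨l', hl', rfl⟩ := hy
    refine ⟨l ++ l', ?_, by simp⟩
    intro x hx
    rcases List.mem_append.1 hx with h | h
    · exact hl x h
    · exact hl' x h
  | inv x _ hx =>
    obtain ⟨l, hl, rfl⟩ := hx
    refine ⟨(l.map (·⁻¹)).reverse, ?_, by rw [List.prod_inv_reverse]⟩
    intro x hx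
    simp only [List.mem_reverse, List.mem_map] at hx
    obtain ⟨a, ha, rfl⟩ := hx
    rcases hl a ha with h | h
    · right; simpa using h
    · left; exact h

theorem wordLength_spec (g : G) :
    ∃ l : List G, l.length = wordLength (Ctx.S (G := G)) g ∧ (∀ x ∈ l, gen x) ∧ l.prod = g := by
  obtain ⟨l, hl, h⟩ := exists_list g
  exact Nat.sInf_mem (s := {n | ∃ l : List G, l.length = n ∧
    (∀ x ∈ l, x ∈ Ctx.S ∨ x⁻¹ ∈ Ctx.S) ∧ l.prod = g}) ⟨_, l, rfl, hl, h⟩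

theorem dst_eq (x y : G) : dst x y = wordLength (Ctx.S (G := G)) (x⁻¹ * y) := rfl

theorem dst_mul_left (g x y : G) : dst (g * x) (g * y) = dst x y := by
  simp [dst_eq, mul_assoc]

theorem dst_le_list (x : G) (l : List G) (hl : ∀ s ∈ l, gen s) : dst x (x * l.prod) ≤ l.length := by
  simpa [dst_eq] using wordLength_le l hl

theorem dst_list (x y : G) :
    ∃ l : List G, l.length = dst x y ∧ (∀ s ∈ l, gen s) ∧ x * l.prod = y := by
  obtain ⟨l, h1, h2, h3⟩ := wordLength_spec (x⁻¹ * y)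
  exact ⟨l, h1, h2, by rw [h3]; group⟩

@[simp] theorem dst_self (x : G) : dst x x = 0 := by
  have := dst_le_list x [] (by simp)
  simpa using this

theorem dst_eq_zero {x y : G} : dst x y = 0 ↔ x = y := by
  refine ⟨fun h => ?_, fun h => h ▸ dst_self x⟩
  obtain ⟨l, h1, -, h3⟩ := dst_list x y
  rw [h, List.length_eq_zero_iff] at h1
  simpa [h1] using h3

theorem dst_tri (x y z : G) : dst x z ≤ dst x y + dst y z := by
  obtain ⟨l, h1, h2, h3⟩ := dst_list x y
  obtain ⟨l', h1', h2', h3'⟩ := dst_list y z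
  have := dst_le_list x (l ++ l') (by
    intro s hs
    rcases List.mem_append.1 hs with h | h
    · exact h2 s h
    · exact h2' s h)
  simpa [← mul_assoc, h3, h3', h1, h1'] using this

theorem dst_comm_le (x y : G) : dst y x ≤ dst x y := by
  obtain ⟨l, h1, h2, h3⟩ := dst_list x y
  have := dst_le_list y (l.map (·⁻¹)).reverse (by
    intro s hs
    simp only [List.mem_reverse, List.mem_map] at hs
    obtain ⟨a, ha, rfl⟩ := hs
    rcases h2 a ha with h | h
    · right; simpa using h
    · left; exact h)
  rw [← List.prod_inv_reverse, ← h3, mul_inv_cancel_right] at this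
  rw [← h3] at h1 ⊢
  simpa [h1] using this

theorem dst_comm (x y : G) : dst x y = dst y x :=
  le_antisymm (dst_comm_le _ _) (dst_comm_le _ _)

theorem dst_gen {x s : G} (hs : gen s) : dst x (x * s) ≤ 1 := by
  simpa using dst_le_list x [s] (by simpa using hs)

theorem exists_step {x z : G} (h : x ≠ z) : ∃ s, gen s ∧ dst (x * s) z < dst x z := by
  obtain ⟨l, h1, h2, h3⟩ := dst_list x z
  cases l with
  | nil => simp at h3; exact absurd h3 h
  | cons s l =>
    refine ⟨s, h2 s (by simp), ?_⟩
    have := dst_le_list (x * s) l (fun t ht => h2 t (by simp [ht]))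
    rw [mul_assoc, ← List.prod_cons, h3] at this
    simp at h1
    omega

theorem finite_ball (r : ℕ) : {a : G | len a ≤ r}.Finite := by
  have hgen : {s : G | gen s}.Finite := by
    have : {s : G | gen s} = Ctx.S ∪ (Ctx.S (G := G))⁻¹ := by ext; simp [gen]
    rw [this]
    exact Ctx.finS.union Ctx.finS.inv
  have : Finite {s : G // gen s} := hgen
  have hf := (List.finite_length_le {s : G // gen s} r).image
    (fun l : List {s : G // gen s} => (l.map Subtype.val).prod)
  refine hf.subset ?_
  intro a ha
  obtain ⟨l, h1, h2, h3⟩ := dst_list 1 a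
  refine ⟨l.attachWith gen h2, ?_, ?_⟩
  · simp only [Set.mem_ofPred_eq, List.length_attachWith]
    exact h1.trans_le ha
  · simpa using h3

/-! ### Canonical geodesics -/

/-- A choice of an element of a set, depending on the set only. -/
def pick (D : Set G) : G := if h : D.Nonempty then h.some else 1

/-- The first step of the canonical geodesic from `1` to `z`. -/
def stp (z : G) : G := pick {s | gen s ∧ dst s z < dst 1 z}

/-- The `n`-th point of the canonical geodesic from `1` to `z` (constant after reaching `z`). -/
def px : ℕ → G → G
  | 0, _ => 1
  | n + 1, z => px n z * stp ((px n z)⁻¹ * z)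

theorem stp_spec {z : G} (h : 1 ≠ z) : gen (stp z) ∧ dst (stp z) z < dst 1 z := by
  have hne : {s | gen s ∧ dst s z < dst 1 z}.Nonempty := by
    obtain ⟨s, hs⟩ := exists_step h
    exact ⟨s, by simpa using hs⟩
  have := hne.some_mem
  simpa [stp, pick, hne] using this

@[simp] theorem stp_one : stp (1 : G) = 1 := by
  simp [stp, pick]

@[simp] theorem px_zero (z : G) : px 0 z = 1 := rfl

theorem px_succ (n : ℕ) (z : G) : px (n + 1) z = px n z * stp ((px n z)⁻¹ * z) := rfl

theorem dst_inv_mul (x s z : G) : dst s (x⁻¹ * z) = dst (x * s) z := by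
  rw [← dst_mul_left x s]; simp

theorem px_step (n : ℕ) (z : G) : dst (px n z) (px (n + 1) z) ≤ 1 := by
  rw [px_succ]
  by_cases h : 1 = (px n z)⁻¹ * z
  · simp [← h]
  · exact dst_gen (stp_spec h).1

theorem dst_px (n : ℕ) (z : G) : dst (px n z) z = len z - n := by
  induction n with
  | zero => rfl
  | succ n ih =>
    have h1 := px_step n z
    by_cases h : 1 = (px n z)⁻¹ * z
    · have : px n z = z := (eq_of_inv_mul_eq_one h.symm)
      rw [this] at ih
      rw [px_succ, ← h]
      simp at ih ⊢
      rw [this]; simp; omega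
    · have h2 := (stp_spec h).2
      rw [dst_inv_mul, dst_inv_mul, ← px_succ] at h2
      have := dst_tri (px n z) (px (n+1) z) z
      simp at h2
      omega

theorem px_dst_le (i j : ℕ) (z : G) : dst (px i z) (px (i + j) z) ≤ j := by
  induction j with
  | zero => simp
  | succ j ih =>
    have := dst_tri (px i z) (px (i + j) z) (px (i + (j + 1)) z)
    have := px_step (i + j) z
    rw [← add_assoc]  at *
    omega

theorem px_dst {i j : ℕ} {z : G} (hij : i ≤ j) (hj : j ≤ len z) :
    dst (px i z) (px j z) = j - i := by
  obtain ⟨k, rfl⟩ := Nat.exists_eq_add_of_le hij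
  have h1 := px_dst_le i k z
  have h2 := dst_tri (px i z) (px (i + k) z) z
  rw [dst_px, dst_px] at h2
  omega

theorem px_len {i : ℕ} {z : G} (hi : i ≤ len z) : len (px i z) = i := by
  have := px_dst (Nat.zero_le i) hi
  simpa [len] using this

theorem px_eq_self {n : ℕ} {z : G} (h : len z ≤ n) : px n z = z := by
  rw [← dst_eq_zero, dst_px]; omega

theorem px_add (k n : ℕ) (z : G) : px (k + n) z = px k z * px n ((px k z)⁻¹ * z) := by
  induction n with
  | zero => simp
  | succ n ih => rw [← add_assoc, px_succ, ih, px_succ]; simp [mul_assoc]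

/-! ### Slim triangles -/

theorem isGeodesicSeg_of {p : ℕ → G} {n : ℕ} (h1 : ∀ i, dst (p i) (p (i + 1)) ≤ 1)
    (h2 : dst (p 0) (p n) = n) : IsGeodesicSeg (Ctx.S (G := G)) p n := by
  have hle : ∀ i j, dst (p i) (p (i + j)) ≤ j := by
    intro i j
    induction j with
    | zero => simp
    | succ j ih =>
      have := dst_tri (p i) (p (i + j)) (p (i + (j + 1)))
      have := h1 (i + j)
      rw [← add_assoc] at *
      omega
  intro i j hij hj
  change dst (p i) (p j) = j - i
  obtain ⟨k, rfl⟩ := Nat.exists_eq_add_of_le hij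
  obtain ⟨l, rfl⟩ := Nat.exists_eq_add_of_le hj
  have a1 := hle 0 i
  have a2 := hle i k
  have a3 := hle (i + k) l
  have a4 := dst_tri (p 0) (p i) (p (i + k + l))
  have a5 := dst_tri (p i) (p (i + k)) (p (i + k + l))
  simp only [zero_add] at a1
  omega

/-- `p` lies on a geodesic from `a` to `b`. -/
def btw (a p b : G) : Prop := dst a p + dst p b = dst a b

theorem btw_symm {a p b : G} (h : btw a p b) : btw b p a := by
  unfold btw at *; rw [dst_comm b p, dst_comm p a, dst_comm b a]; omega

theorem exists_geodesic {a p b : G} (h : btw a p b) :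
    ∃ q : ℕ → G, IsGeodesicSeg (Ctx.S (G := G)) q (dst a b) ∧ q 0 = a ∧ q (dst a b) = b ∧
      q (dst a p) = p := by
  have hap : len (a⁻¹ * p) = dst a p := by simp [len, dst_inv_mul]
  have hpb : len (p⁻¹ * b) = dst p b := by simp [len, dst_inv_mul]
  let q : ℕ → G := fun i => if i ≤ dst a p then a * px i (a⁻¹ * p)
    else p * px (i - dst a p) (p⁻¹ * b)
  have q0 : q 0 = a := by simp [q]
  have qp : q (dst a p) = p := by simp [q, px_eq_self hap.le]
  have qb : q (dst a b) = b := by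
    by_cases h' : dst a b ≤ dst a p
    · have h0 : dst p b = 0 := by unfold btw at h; omega
      have hpb' := dst_eq_zero.1 h0
      rw [← hpb', qp]
    · have : len (p⁻¹ * b) ≤ dst a b - dst a p := by unfold btw at h; omega
      simp only [q, h', if_false, px_eq_self this]
      simp
  refine ⟨q, isGeodesicSeg_of ?_ (by rw [q0, qb]), q0, qb, qp⟩
  intro i
  rcases lt_trichotomy i (dst a p) with hi | hi | hi
  · simp only [q, hi.le, if_true, Nat.succ_le_of_lt hi, dst_mul_left]
    exact px_step _ _
  · subst hi
    have h1 : ¬ dst a p + 1 ≤ dst a p := by omega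
    rw [qp]
    simp only [q, h1, if_false, Nat.add_sub_cancel_left]
    have := px_step 0 (p⁻¹ * b)
    rw [← dst_mul_left p] at this
    simpa using this
  · have h1 : ¬ i ≤ dst a p := by omega
    have h2 : ¬ i + 1 ≤ dst a p := by omega
    simp only [q, h1, h2, if_false, dst_mul_left]
    rw [show i + 1 - dst a p = i - dst a p + 1 by omega]
    exact px_step _ _

theorem btw_of_seg {q : ℕ → G} {n j : ℕ} (h : IsGeodesicSeg (Ctx.S (G := G)) q n) (hj : j ≤ n) :
    btw (q 0) (q j) (q n) := by
  have h1 : dst (q 0) (q j) = j - 0 := h 0 j (Nat.zero_le _) hj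
  have h2 : dst (q j) (q n) = n - j := h j n hj le_rfl
  have h3 : dst (q 0) (q n) = n - 0 := h 0 n (Nat.zero_le _) le_rfl
  unfold btw; omega

theorem btw_left (a b : G) : btw a a b := by simp [btw]

theorem slim_btw {a p b : G} (h : btw a p b) (c : G) :
    ∃ q, dst p q ≤ Ctx.δ G ∧ (btw a q c ∨ btw c q b) := by
  obtain ⟨f, hf, f0, fb, fp⟩ := exists_geodesic h
  obtain ⟨g, hg, g0, gc, -⟩ := exists_geodesic (btw_left b c)
  obtain ⟨k, hk, k0, ka, -⟩ := exists_geodesic (btw_left c a)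
  obtain ⟨j, hj | hj⟩ := Ctx.slim f g k _ _ _ hf hg hk (fb.trans g0.symm) (gc.trans k0.symm)
    (ka.trans f0.symm) (dst a p) (by unfold btw at h; omega)
  · refine ⟨g j, ?_, Or.inr (btw_symm ?_)⟩
    · have := hj.2
      rw [fp] at this
      exact_mod_cast this
    · have := btw_of_seg hg hj.1
      rwa [g0, gc] at this
  · refine ⟨k j, ?_, Or.inl (btw_symm ?_)⟩
    · have := hj.2
      rw [fp] at this
      exact_mod_cast this
    · have := btw_of_seg hk hj.1
      rwa [k0, ka] at this

/-! ### Local horofunctions -/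

/-- The distance functions of `y` and `z` differ by a constant on the ball `B(x, r)`. -/
def hc (x : G) (r : ℕ) (y z : G) : Prop :=
  ∀ a, dst x a ≤ r → (dst a y : ℤ) - dst x y = dst a z - dst x z

theorem hc_refl (x : G) (r : ℕ) (y : G) : hc x r y y := fun _ _ => rfl

theorem hc_symm {x : G} {r : ℕ} {y z : G} (h : hc x r y z) : hc x r z y :=
  fun a ha => (h a ha).symm

theorem hc_trans {x : G} {r : ℕ} {y z w : G} (h : hc x r y z) (h' : hc x r z w) : hc x r y w :=
  fun a ha => (h a ha).trans (h' a ha)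

theorem hc_mul_left (g x : G) (r : ℕ) (y z : G) : hc (g * x) r (g * y) (g * z) ↔ hc x r y z := by
  refine ⟨fun h a ha => ?_, fun h a ha => ?_⟩
  · have := h (g * a) (by rwa [dst_mul_left])
    simpa only [dst_mul_left] using this
  · have := h (g⁻¹ * a) (by rw [← dst_mul_left g]; simpa using ha)
    rw [← dst_mul_left g (g⁻¹ * a), ← dst_mul_left g (g⁻¹ * a), ← dst_mul_left g x,
      ← dst_mul_left g x] at this
    simpa using this

theorem hc_eq {x : G} {r : ℕ} {y z : G} (hr : 1 ≤ r) (h : hc x r y z) (hz : x = z) : x = y := by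
  by_contra hy
  obtain ⟨s, hs, hs'⟩ := exists_step hy
  have := h (x * s) ((dst_gen hs).trans hr)
  subst hz
  simp only [dst_self] at this
  omega

theorem hc_stp {x : G} {r : ℕ} {y z : G} (hr : 1 ≤ r) (h : hc x r y z) :
    stp (x⁻¹ * y) = stp (x⁻¹ * z) := by
  unfold stp
  congr 1
  ext s
  simp only [Set.mem_ofPred_eq, dst_inv_mul, mul_one, and_congr_right_iff]
  intro hs
  have := h (x * s) ((dst_gen hs).trans hr)
  omega

theorem hc_of_btw {x : G} {r : ℕ} {y z a p q : G} (h : hc x r y z) (hp : btw a p y)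
    (hq : btw a q z) (hxp : dst x p ≤ r) (hxq : dst x q ≤ r) :
    (dst a y : ℤ) - dst x y = dst a z - dst x z := by
  have h1 := h p hxp
  have h2 := h q hxq
  have h3 := dst_tri a q y
  have h4 := dst_tri a p z
  unfold btw at hp hq
  omega

/-- The radius of the balls at which horofunctions are recorded. -/
def rad (G : Type) [Group G] [Ctx G] : ℕ := 2 * Ctx.δ G

theorem one_le_rad : 1 ≤ rad G := by
  have := Ctx.δpos (G := G); unfold rad; omega

/-- The class of `z` at level `n`. -/
def A (n : ℕ) (z : G) : Set G := {y | ∀ i ≤ n, hc (px i z) (rad G) y z}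

theorem self_mem_A (n : ℕ) (z : G) : z ∈ A n z := fun _ _ => hc_refl _ _ _

theorem A_mono {m n : ℕ} (h : m ≤ n) {z : G} : A n z ⊆ A m z :=
  fun _ hy i hi => hy i (hi.trans h)

theorem A_px_succ {n : ℕ} {y z : G} (h : y ∈ A n z) : ∀ i ≤ n + 1, px i y = px i z := by
  intro i
  induction i with
  | zero => intro _; rfl
  | succ i ih =>
    intro hi
    rw [px_succ, px_succ, ih (by omega), hc_stp one_le_rad (h i (by omega))]

theorem A_px {n : ℕ} {y z : G} (h : y ∈ A n z) {i : ℕ} (hi : i ≤ n) : px i y = px i z :=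
  A_px_succ h i (by omega)

theorem A_eq {n : ℕ} {y z : G} (h : y ∈ A n z) : A n y = A n z := by
  ext w
  refine ⟨fun hw i hi => ?_, fun hw i hi => ?_⟩
  · have := hw i hi
    rw [A_px h hi] at this
    exact hc_trans this (h i hi)
  · rw [A_px h hi]
    exact hc_trans (hw i hi) (hc_symm (h i hi))

theorem A_symm {n : ℕ} {y z : G} (h : y ∈ A n z) : z ∈ A n y := by
  rw [A_eq h]; exact self_mem_A _ _

theorem A_of_len_le {n : ℕ} {y z : G} (h : y ∈ A n z) (hn : len z ≤ n) : y = z := by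
  have := h _ hn
  rw [px_eq_self le_rfl] at this
  exact (hc_eq one_le_rad this rfl).symm

theorem A_len {n : ℕ} {y z : G} (h : y ∈ A n z) (hn : n ≤ len z) : n ≤ len y := by
  by_contra hlt
  push Not at hlt
  have := A_of_len_le (A_symm (h)) (by omega)
  rw [this] at hn
  omega

theorem mem_A_add {k n : ℕ} {y v : G} :
    v ∈ A (k + n) y ↔ v ∈ A k y ∧ (px k y)⁻¹ * v ∈ A n ((px k y)⁻¹ * y) := by
  have key : ∀ i, hc (px i ((px k y)⁻¹ * y)) (rad G) ((px k y)⁻¹ * v) ((px k y)⁻¹ * y) ↔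
      hc (px (k + i) y) (rad G) v y := by
    intro i
    rw [← hc_mul_left (px k y), ← px_add]
    simp
  refine ⟨fun h => ⟨A_mono (by omega) h, fun i hi => ?_⟩, fun h i hi => ?_⟩
  · exact (key i).2 (h _ (by omega))
  · by_cases hik : i ≤ k
    · exact h.1 i hik
    · obtain ⟨j, rfl⟩ := Nat.exists_eq_add_of_le (not_le.1 hik).le
      exact (key j).1 (h.2 j (by omega))

theorem btw_px {i j : ℕ} {z : G} (hij : i ≤ j) (hj : j ≤ len z) : btw (px i z) (px j z) z := by
  unfold btw
  rw [px_dst hij hj, dst_px, dst_px]; omega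

/-- Deep classes determine the horofunction on a given ball. -/
theorem hc_of_mem_A (M : ℕ) {m : ℕ} (hm : M + Ctx.δ G < m) {y z : G} (h : y ∈ A m z) :
    hc 1 M y z := by
  by_cases hlen : len z ≤ m
  · rw [A_of_len_le h hlen]; exact hc_refl _ _ _
  have hz : m ≤ len z := by omega
  have hy := A_len h hz
  have key : ∀ w : G, px m w = px m z → m ≤ len w → ∀ a, dst 1 a ≤ M →
      ∃ p, btw a p w ∧ dst (px m z) p ≤ rad G := by
    intro w hw hmw a ha
    have h1 : btw 1 (px m w) w := btw_px (Nat.zero_le m) hmw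
    obtain ⟨q, hq, hq' | hq'⟩ := slim_btw h1 a
    · exfalso
      have h2 := dst_tri 1 q (px m w)
      have h3 : dst 1 (px m w) = m := px_len hmw
      rw [dst_comm] at hq
      unfold btw at hq'
      omega
    · refine ⟨q, hq', ?_⟩
      rw [← hw]; unfold rad; omega
  have key2 : ∀ a, dst 1 a ≤ M →
      (dst a y : ℤ) - dst (px m z) y = dst a z - dst (px m z) z := by
    intro a ha
    obtain ⟨p, hp, hp'⟩ := key y (A_px h le_rfl) hy a ha
    obtain ⟨q, hq, hq'⟩ := key z rfl hz a ha
    exact hc_of_btw (h m le_rfl) hp hq hp' hq'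
  intro a ha
  have h1 := key2 a ha
  have h2 := key2 1 (by simp)
  omega

/-- The level-`n` class of `z` in `d`, seen from the `n`-th point of the geodesic to `z`. -/
def V (d : Set G) (n : ℕ) (z : G) : Set G := {w | px n z * w ∈ d ∧ px n z * w ∈ A n z}

/-- Membership in a type depends only on the horofunction on a ball of fixed radius. -/
theorem V_saturated {n : ℕ} {z w w' : G} (hw : w ∈ V Set.univ n z)
    (h : hc 1 (4 * Ctx.δ G + 1) w w') : w' ∈ V Set.univ n z := by
  have hδ := Ctx.δpos (G := G)
  obtain ⟨-, hw⟩ := hw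
  obtain ⟨y, hy⟩ : ∃ y, y = px n z * w := ⟨_, rfl⟩
  rw [← hy] at hw
  have hpx : px n y = px n z := A_px hw le_rfl
  refine ⟨trivial, ?_⟩
  rw [← A_eq hw, ← hpx]
  have hwy : w = (px n y)⁻¹ * y := by rw [hpx, hy]; simp
  have hc1 : hc (px n y) (4 * Ctx.δ G + 1) y (px n y * w') := by
    have := (hc_mul_left (px n y) _ _ _ _).2 h
    rw [hwy] at this
    simpa using this
  clear h hwy hpx hy hw
  generalize px n y * w' = y' at *
  by_cases hn : len y ≤ n
  · rw [px_eq_self hn] at hc1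
    rw [← hc_eq (by omega) (hc_symm hc1) rfl]
    exact self_mem_A _ _
  have hn : n ≤ len y := by omega
  have step1 : ∀ i ≤ n, (dst (px i y) y : ℤ) - dst (px n y) y =
      dst (px i y) y' - dst (px n y) y' := by
    intro i hi
    by_cases hni : n ≤ i + (Ctx.δ G + 1)
    · apply hc1
      rw [dst_comm, px_dst hi hn]; omega
    have hj : n - (Ctx.δ G + 1) ≤ n := by omega
    set j := n - (Ctx.δ G + 1) with hjdef
    have hq := px_dst hj hn
    have hjn := hc1 (px j y) (by rw [dst_comm, hq]; omega)
    rw [dst_px, dst_px] at hjn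
    have hb : btw (px i y) (px j y) (px n y) := by
      unfold btw; rw [px_dst (by omega) (by omega), px_dst (by omega) hn, px_dst hi hn]; omega
    obtain ⟨p, hp, hp' | hp'⟩ := slim_btw hb y'
    · refine hc_of_btw hc1 (btw_px hi hn) hp' (by simp) ?_
      have := dst_tri (px n y) (px j y) p
      rw [dst_comm (px n y) (px j y), hq] at this
      omega
    · exfalso
      have h1 := dst_tri (px j y) p y'
      unfold btw at hp'
      rw [dst_comm p y'] at h1
      rw [dst_comm y' (px n y)] at hp'
      omega
  intro i hi
  have hb' : btw (px i y) (px n y) y' := by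
    have := step1 i hi
    rw [dst_px, dst_px] at this
    unfold btw
    rw [px_dst hi hn]
    omega
  have step2 : ∀ a, dst (px i y) a ≤ rad G → (dst a y : ℤ) - dst (px n y) y =
      dst a y' - dst (px n y) y' := by
    intro a ha
    by_cases hfar : dst (px n y) a ≤ 4 * Ctx.δ G + 1
    · exact hc1 a hfar
    have key : ∀ v, btw (px i y) (px n y) v → ∃ p, btw a p v ∧ dst (px n y) p ≤ Ctx.δ G := by
      intro v hv
      obtain ⟨p, hp, hp' | hp'⟩ := slim_btw hv a
      · exfalso
        have := dst_tri (px n y) p a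
        unfold btw at hp'
        unfold rad at ha
        omega
      · exact ⟨p, hp', hp⟩
    obtain ⟨p, hp, hp'⟩ := key y (btw_px hi hn)
    obtain ⟨q, hq, hq'⟩ := key y' hb'
    exact hc_of_btw hc1 hp hq (by omega) (by omega)
  intro a ha
  have h1 := step2 a ha
  have h2 := step2 (px i y) (by simp)
  omega

/-- Contraction: translates of deep classes lie in classes whose base point is close. -/
theorem contraction (u : G) : ∃ L, ∀ n ≥ L, ∀ z : G, n ≤ len z → ∃ j ≤ len (u * z),
    (∀ y ∈ A n z, u * y ∈ A j (u * z)) ∧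
      len ((px j (u * z))⁻¹ * (u * px n z)) ≤ 5 * Ctx.δ G + 1 := by
  have hδ := Ctx.δpos (G := G)
  refine ⟨len u + 10 * Ctx.δ G + 10, fun n hn z hz => ?_⟩
  have hu : dst 1 u⁻¹ = len u := by
    rw [dst_comm, ← dst_mul_left u]; simp [len]
  set x := px n z with hx
  have hxlen : dst 1 x = n := px_len hz
  -- the geodesic from `u⁻¹` to `z`
  let c : ℕ → G := fun i => u⁻¹ * px i (u * z)
  have c0 : c 0 = u⁻¹ := by simp [c]
  have clen : len (u * z) = dst u⁻¹ z := by
    unfold len; rw [← dst_mul_left u u⁻¹ z]; simp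
  have cd : ∀ i j, i ≤ j → j ≤ len (u * z) → dst (c i) (c j) = j - i := by
    intro i j hij hj
    simp only [c, dst_mul_left]; exact px_dst hij hj
  have cz : ∀ i, dst (c i) z = len (u * z) - i := by
    intro i
    rw [← dst_mul_left u]; simp only [c, mul_inv_cancel_left]; exact dst_px _ _
  obtain ⟨l, hl, hxl⟩ : ∃ l ≤ len (u * z), dst x (c l) ≤ Ctx.δ G := by
    have hgeo : IsGeodesicSeg (Ctx.S (G := G)) c (len (u * z)) := by
      intro i j hij hj
      exact cd i j hij hj
    have cend : c (len (u * z)) = z := by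
      rw [← dst_eq_zero, cz]; omega
    obtain ⟨f, hf, f0, fb, fp⟩ := exists_geodesic (btw_px (Nat.zero_le n) hz)
    obtain ⟨k, hk, k0, ka, -⟩ := exists_geodesic (btw_left (px 0 z) u⁻¹)
    obtain ⟨g, hg, g0, gb, -⟩ := exists_geodesic (btw_left u⁻¹ (px 0 z))
    have hrev : IsGeodesicSeg (Ctx.S (G := G)) (fun i => c (len (u * z) - i)) (len (u * z)) := by
      intro i j hij hj
      change dst (c (len (u * z) - i)) (c (len (u * z) - j)) = j - i
      rw [dst_comm, cd _ _ (by omega) (by omega)]; omega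
    obtain ⟨j, hj | hj⟩ := Ctx.slim f (fun i => c (len (u * z) - i)) g _ _ _ hf hrev hg
      (by rw [fb]; simp [cend]) (by simp [g0, c0]) (by rw [gb, f0]) (dst (px 0 z) (px n z))
      (by have := btw_px (Nat.zero_le n) hz; unfold btw at this; omega)
    · refine ⟨len (u * z) - j, by omega, ?_⟩
      have := hj.2
      rw [fp] at this
      exact_mod_cast this
    · exfalso
      have h1 := hj.2
      rw [fp] at h1
      have h2 : dst x (g j) ≤ Ctx.δ G := by exact_mod_cast h1
      have h3 := btw_of_seg hg hj.1
      rw [g0, gb, px_zero] at h3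
      have h4 := dst_tri 1 (g j) x
      unfold btw at h3
      rw [dst_comm u⁻¹ 1, hu, dst_comm (g j) 1] at h3
      rw [dst_comm x] at h2
      omega
  have hl1 : n ≤ len u + Ctx.δ G + l := by
    have h1 := dst_tri 1 u⁻¹ x
    have h2 := dst_tri u⁻¹ (c l) x
    have h3 := cd 0 l (Nat.zero_le _) hl
    rw [c0] at h3
    rw [dst_comm x] at hxl
    omega
  obtain ⟨j, rfl⟩ : ∃ j, l = j + (4 * Ctx.δ G + 1) := ⟨l - (4 * Ctx.δ G + 1), by omega⟩
  set l := j + (4 * Ctx.δ G + 1) with hldef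
  refine ⟨j, by omega, fun y hy => ?_, ?_⟩
  · have hcx : hc x (rad G) y z := hy n le_rfl
    have hcu : (dst u⁻¹ y : ℤ) - dst x y = dst u⁻¹ z - dst x z := by
      have h1 := hc_of_mem_A (len u) (m := n) (by omega) hy
      have h2 := h1 u⁻¹ hu.le
      have hyn : n ≤ len y := A_len hy hz
      have h3 : dst x y = len y - n := by rw [hx, ← A_px hy le_rfl, dst_px]
      have h4 : dst x z = len z - n := by rw [hx, dst_px]
      change (dst u⁻¹ y : ℤ) - len y = dst u⁻¹ z - len z at h2
      omega
    have hcl := hcx (c l) (by unfold rad; omega)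
    have hcl0 := cd 0 l (Nat.zero_le _) hl
    rw [c0] at hcl0
    have key : ∀ i ≤ j, ∀ a, dst (c i) a ≤ rad G →
        (dst a y : ℤ) - dst x y = dst a z - dst x z := by
      intro i hi a ha
      have hil := cd i l (by omega) hl
      have h0i := cd 0 i (by omega) (by omega)
      rw [c0] at h0i
      have key2 : ∀ v, btw (c i) (c l) v → ∃ p, btw a p v ∧ dst x p ≤ rad G := by
        intro v hv
        obtain ⟨p, hp, hp' | hp'⟩ := slim_btw hv a
        · exfalso
          have h1 := dst_tri (c i) p (c l)
          unfold btw at hp'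
          rw [dst_comm p] at h1
          unfold rad at ha
          omega
        · refine ⟨p, hp', ?_⟩
          have := dst_tri x (c l) p
          unfold rad; omega
      have hbz : btw (c i) (c l) z := by
        unfold btw; rw [cz, cz]; omega
      have hby : btw (c i) (c l) y := by
        have h1 := dst_tri u⁻¹ (c i) y
        have h2 := dst_tri (c i) (c l) y
        have h3 := cz l
        unfold btw
        omega
      obtain ⟨p, hp, hp'⟩ := key2 y hby
      obtain ⟨q, hq, hq'⟩ := key2 z hbz
      exact hc_of_btw hcx hp hq hp' hq'
    intro i hi
    rw [← hc_mul_left u⁻¹]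
    simp only [inv_mul_cancel_left]
    intro a ha
    have h1 := key i hi a ha
    have h2 := key i hi (c i) (by simp)
    change (dst a y : ℤ) - dst (c i) y = dst a z - dst (c i) z
    omega
  · have h1 : len ((px j (u * z))⁻¹ * (u * x)) = dst (c j) x := by
      unfold len
      rw [dst_inv_mul, ← dst_mul_left u (c j)]
      simp [c]
    rw [h1]
    have := dst_tri (c j) (c l) x
    have h2 := cd j l (by omega) hl
    rw [dst_comm x] at hxl
    omega

/-! ### Types of classes -/

/-- `P` is a type of classes. -/
def IsVx (P : Set G) : Prop := ∃ n z, P = V Set.univ n z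

/-- `d` is a type or the whole group. -/
def Good (d : Set G) : Prop := d = Set.univ ∨ IsVx d

theorem good_univ : Good (Set.univ : Set G) := Or.inl rfl

theorem tail_mem_V {d : Set G} (n : ℕ) {z : G} (hz : z ∈ d) : (px n z)⁻¹ * z ∈ V d n z := by
  simp [V, hz, self_mem_A]

theorem V_eq {d : Set G} {n : ℕ} {y z : G} (h : y ∈ A n z) : V d n y = V d n z := by
  unfold V; rw [A_eq h, A_px h le_rfl]

theorem V_add_self (d : Set G) (k n : ℕ) (y : G) :
    V (V d k y) n ((px k y)⁻¹ * y) = V d (k + n) y := by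
  ext v
  simp only [V, Set.mem_ofPred_eq, px_add, mem_A_add (k := k) (n := n), mul_assoc,
    inv_mul_cancel_left]
  tauto

theorem V_add {d : Set G} {k : ℕ} {z w : G} (hw : w ∈ V d k z) (n : ℕ) :
    V (V d k z) n w = V d (k + n) (px k z * w) := by
  have := V_add_self d k n (px k z * w)
  rw [V_eq hw.2, A_px hw.2 le_rfl] at this
  simpa using this

theorem V_of_len_le {d : Set G} {n : ℕ} {z : G} (hz : z ∈ d) (h : len z ≤ n) : V d n z = {1} := by
  ext v
  simp only [V, Set.mem_ofPred_eq, Set.mem_singleton_iff, px_eq_self h]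
  refine ⟨fun hv => by simpa using A_of_len_le hv.2 h, ?_⟩
  rintro rfl
  simpa [hz] using self_mem_A n z

theorem len_le_of_V {d : Set G} {n : ℕ} {z : G} (hz : z ∈ d) (h : V d n z = {1}) : len z ≤ n := by
  have := tail_mem_V n hz
  rw [h, Set.mem_singleton_iff, inv_mul_eq_one] at this
  have h2 := dst_px n z
  rw [this, dst_self] at h2
  omega

theorem IsVx.V_zero {P : Set G} (hP : IsVx P) {w : G} (hw : w ∈ P) : V P 0 w = P := by
  obtain ⟨n, z, rfl⟩ := hP
  rw [V_add hw]
  exact V_eq hw.2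

theorem IsVx.nonempty {P : Set G} (hP : IsVx P) : P.Nonempty := by
  obtain ⟨n, z, rfl⟩ := hP
  exact ⟨_, tail_mem_V n (Set.mem_univ z)⟩

theorem Good.isVx_V {d : Set G} (hd : Good d) (n : ℕ) {z : G} (hz : z ∈ d) : IsVx (V d n z) := by
  rcases hd with rfl | ⟨k, y, rfl⟩
  · exact ⟨n, z, rfl⟩
  · rw [V_add hz]; exact ⟨_, _, rfl⟩

theorem isVx_one : IsVx ({1} : Set G) :=
  ⟨0, 1, (V_of_len_le (Set.mem_univ _) (by simp [len])).symm⟩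

theorem IsVx.saturated {P : Set G} (hP : IsVx P) {w w' : G} (hw : w ∈ P)
    (h : hc 1 (4 * Ctx.δ G + 1) w w') : w' ∈ P := by
  obtain ⟨n, z, rfl⟩ := hP
  exact V_saturated hw h

theorem mem_A_succ {d : Set G} {n : ℕ} {z z' : G} (h : z' ∈ A n z) (hz' : z' ∈ d)
    (hV : V d (n + 1) z = V d (n + 1) z') : z' ∈ A (n + 1) z := by
  have h1 := tail_mem_V (n + 1) hz'
  rw [← hV] at h1
  have h2 := h1.2
  rw [A_px_succ h (n + 1) le_rfl] at h2
  simpa using h2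

theorem mem_A_zero {d : Set G} {z z' : G} (hz' : z' ∈ d) (hV : V d 0 z = V d 0 z') :
    z' ∈ A 0 z := by
  have h1 := tail_mem_V 0 hz'
  rw [← hV] at h1
  simpa using h1.2

theorem finite_isVx : {P : Set G | IsVx P}.Finite := by
  set r := 4 * Ctx.δ G + 1
  have hfin : Finite {a : G // len a ≤ r} := finite_ball r
  let Φ : G → {a : G // len a ≤ r} → Fin (2 * r + 1) := fun z a =>
    Fin.ofNat _ ((dst a.1 z + r) - dst 1 z)
  have hΦ : ∀ z z', Φ z = Φ z' → hc 1 r z z' := by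
    intro z z' h a ha
    have h1 := congrArg Fin.val (congrFun h ⟨a, ha⟩)
    simp only [Φ, Fin.val_ofNat] at h1
    have h2 := dst_tri 1 a z
    have h3 := dst_tri 1 a z'
    have h4 := dst_tri a 1 z
    have h5 := dst_tri a 1 z'
    rw [dst_comm a 1] at h4 h5
    rw [Nat.mod_eq_of_lt (by omega), Nat.mod_eq_of_lt (by omega)] at h1
    omega
  refine (Set.finite_range (fun T : Set ({a : G // len a ≤ r} → Fin (2 * r + 1)) =>
    Φ ⁻¹' T)).subset ?_
  intro P hP
  refine ⟨Φ '' P, ?_⟩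
  ext w'
  refine ⟨?_, fun h => ⟨w', h, rfl⟩⟩
  rintro ⟨w, hw, hww⟩
  exact hP.saturated hw (hΦ _ _ hww)

/-! ### The graph -/

/-- The nodes of the graph. -/
abbrev Vt (G : Type) [Group G] [Ctx G] : Type := {P : Set G // IsVx P}

instance : Finite (Vt G) := finite_isVx

/-- The edges of the graph: from a nontrivial type to its children, and two edges
from the trivial type to every type. -/
abbrev Ed (G : Type) [Group G] [Ctx G] : Type :=
  {e : Vt G × Vt G × Bool // e.1.1 = {1} ∨ (e.2.2 = false ∧ ∃ w ∈ e.1.1, e.2.1.1 = V e.1.1 1 w)}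

instance : Finite (Ed G) := Subtype.finite

/-- The graph of types. -/
def graph (G : Type) [Group G] [Ctx G] : FinDigraph :=
  @FinDigraph.mk (Vt G) (Ed G) (Fintype.ofFinite _) (Fintype.ofFinite _)
    (fun e => e.1.1) (fun e => e.1.2.1)

/-- The origin of an edge, as a set. -/
def src (e : (graph G).E) : Set G := ((graph G).o e).1

/-- The terminus of an edge, as a set. -/
def tgt (e : (graph G).E) : Set G := ((graph G).t e).1

/-- An edge leaving the trivial type. -/
def outE (P : Vt G) (b : Bool) : (graph G).E :=
  (⟨(⟨{1}, isVx_one⟩, P, b), Or.inl rfl⟩ : Ed G)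

/-- The edge from `P` to its child `Q`. -/
def mkE (P Q : Set G) : (graph G).E :=
  if h : IsVx P ∧ IsVx Q ∧ (P = {1} ∨ ∃ w ∈ P, Q = V P 1 w) then
    (⟨(⟨P, h.1⟩, ⟨Q, h.2.1⟩, false), h.2.2.imp_right fun h' => ⟨rfl, h'⟩⟩ : Ed G)
  else outE ⟨{1}, isVx_one⟩ false

theorem mkE_eq {P Q : Set G} (h : IsVx P ∧ IsVx Q ∧ (P = {1} ∨ ∃ w ∈ P, Q = V P 1 w)) :
    mkE P Q = (⟨(⟨P, h.1⟩, ⟨Q, h.2.1⟩, false), h.2.2.imp_right fun h' => ⟨rfl, h'⟩⟩ : Ed G) :=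
  dif_pos h

theorem isVx_src (e : (graph G).E) : IsVx (src e) := ((graph G).o e).2

theorem edge_cases (e : (graph G).E) (h : src e ≠ {1}) :
    ∃ w ∈ src e, e = mkE (src e) (V (src e) 1 w) := by
  obtain ⟨⟨⟨P, hP⟩, ⟨Q, hQ⟩, b⟩, he⟩ := e
  rcases he with he | ⟨hb, w, hw, he⟩
  · exact absurd he h
  · refine ⟨w, hw, ?_⟩
    simp only at hb he hw
    subst hb
    subst he
    have : IsVx P ∧ IsVx (V P 1 w) ∧ (P = {1} ∨ ∃ w' ∈ P, V P 1 w = V P 1 w') :=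
      ⟨hP, hQ, Or.inr ⟨w, hw, rfl⟩⟩
    exact (mkE_eq this).symm

theorem src_inj {e e' : (graph G).E} : src e = src e' ↔ (graph G).o e = (graph G).o e' :=
  ⟨fun h => Subtype.ext h, fun h => congrArg Subtype.val h⟩

/-- The `i`-th edge of the path to `z` in the tree of classes of `d`. -/
def ed (d : Set G) (i : ℕ) (z : G) : (graph G).E := mkE (V d i z) (V d (i + 1) z)

theorem ed_valid {d : Set G} (hd : Good d) {z : G} (hz : z ∈ d) (i : ℕ) :
    IsVx (V d i z) ∧ IsVx (V d (i + 1) z) ∧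
      (V d i z = {1} ∨ ∃ w ∈ V d i z, V d (i + 1) z = V (V d i z) 1 w) :=
  ⟨hd.isVx_V _ hz, hd.isVx_V _ hz, Or.inr ⟨_, tail_mem_V i hz, (V_add_self d i 1 z).symm⟩⟩

theorem src_ed {d : Set G} (hd : Good d) {z : G} (hz : z ∈ d) (i : ℕ) :
    src (ed d i z) = V d i z := by
  rw [ed, mkE_eq (ed_valid hd hz i)]; rfl

theorem tgt_ed {d : Set G} (hd : Good d) {z : G} (hz : z ∈ d) (i : ℕ) :
    tgt (ed d i z) = V d (i + 1) z := by
  rw [ed, mkE_eq (ed_valid hd hz i)]; rfl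

theorem mem_shift {x : ℕ → (graph G).E} :
    x ∈ (graph G).shift ↔ ∀ i, tgt (x i) = src (x (i + 1)) :=
  ⟨fun h i => congrArg Subtype.val (h i), fun h i => Subtype.ext (h i)⟩

/-- The infinite paths coding points of the completion of `d`. -/
def K (d : Set G) : Set (ℕ → (graph G).E) :=
  {x | x ∈ (graph G).shift ∧ ∃ z ∈ d, src (x 0) = V d 0 z}

theorem mem_K_vx {P : Set G} (hP : IsVx P) {x : ℕ → (graph G).E} :
    x ∈ K P ↔ x ∈ (graph G).shift ∧ src (x 0) = P := by
  refine and_congr_right fun _ => ⟨?_, fun h => ?_⟩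
  · rintro ⟨z, hz, h⟩; rw [h, hP.V_zero hz]
  · obtain ⟨z, hz⟩ := hP.nonempty
    exact ⟨z, hz, by rw [h, hP.V_zero hz]⟩

theorem mem_K_one {x : ℕ → (graph G).E} :
    x ∈ K {1} ↔ x ∈ (graph G).shift ∧ src (x 0) = {1} := mem_K_vx isVx_one

theorem mem_K_of_approx {d : Set G} {x : ℕ → (graph G).E}
    (h : ∀ m, ∃ y ∈ K d, ∀ i < m, x i = y i) : x ∈ K d := by
  refine ⟨?_, ?_⟩
  · intro i
    obtain ⟨y, hy, hxy⟩ := h (i + 2)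
    rw [hxy i (by omega), hxy (i + 1) (by omega)]
    exact hy.1 i
  · obtain ⟨y, hy, hxy⟩ := h 1
    rw [hxy 0 (by omega)]
    exact hy.2

/-- The path to the element `z` of `d`, followed by `τ`. -/
def pt (d : Set G) (z : G) (τ : ℕ → (graph G).E) : ℕ → (graph G).E :=
  fun i => if i < len z then ed d i z else τ (i - len z)

theorem src_pt {d : Set G} (hd : Good d) {z : G} (hz : z ∈ d) {τ : ℕ → (graph G).E}
    (hτ : τ ∈ K {1}) {i : ℕ} (hi : i ≤ len z) : src (pt d z τ i) = V d i z := by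
  rcases hi.lt_or_eq with hi | hi
  · rw [pt, if_pos hi, src_ed hd hz]
  · rw [pt, if_neg (by omega), hi, Nat.sub_self, (mem_K_one.1 hτ).2, V_of_len_le hz le_rfl]

theorem pt_mem {d : Set G} (hd : Good d) {z : G} (hz : z ∈ d) {τ : ℕ → (graph G).E}
    (hτ : τ ∈ K {1}) : pt d z τ ∈ K d := by
  refine ⟨mem_shift.2 fun i => ?_, z, hz, src_pt hd hz hτ (Nat.zero_le _)⟩
  by_cases hi : i < len z
  · rw [src_pt hd hz hτ hi, pt, if_pos hi, tgt_ed hd hz]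
  · rw [pt, pt, if_neg hi, if_neg (by omega), show i + 1 - len z = i - len z + 1 by omega]
    exact mem_shift.1 hτ.1 _

theorem pt_one (d : Set G) (τ : ℕ → (graph G).E) : pt d 1 τ = τ := by
  funext i; simp [pt, len]

/-- The constant path at the trivial type. -/
def loopPath (b : Bool) : ℕ → (graph G).E := fun _ => outE ⟨{1}, isVx_one⟩ b

theorem loopPath_mem (b : Bool) : (loopPath b : ℕ → (graph G).E) ∈ K {1} :=
  mem_K_one.2 ⟨fun _ => rfl, rfl⟩

theorem loopPath_ne : (loopPath true : ℕ → (graph G).E) 0 ≠ loopPath false 0 := by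
  intro h
  have : ((loopPath true : ℕ → Ed G) 0).1.2.2 = ((loopPath false : ℕ → Ed G) 0).1.2.2 :=
    congrArg (fun e : Ed G => e.1.2.2) h
  simp [loopPath, outE] at this

/-- Paths through the same edges lead to elements of the same class. -/
theorem pt_agree {d : Set G} (hd : Good d) {z z' : G} (hz : z ∈ d) (hz' : z' ∈ d)
    {τ τ' : ℕ → (graph G).E} (hτ : τ ∈ K {1}) (hτ' : τ' ∈ K {1}) (n : ℕ)
    (h : ∀ i < n, pt d z τ i = pt d z' τ' i) :
    z = z' ∨ (n ≤ len z ∧ n ≤ len z' ∧ (0 < n → z' ∈ A n z)) := by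
  induction n with
  | zero => right; simp
  | succ n ih =>
    rcases ih fun i hi => h i (by omega) with h0 | ⟨h1, h2, h3⟩
    · exact Or.inl h0
    by_cases hzz : z = z'
    · exact Or.inl hzz
    right
    have hn := h n (by omega)
    have hV : V d n z = V d n z' := by
      rw [← src_pt hd hz hτ h1, ← src_pt hd hz' hτ' h2, hn]
    have hA : z' ∈ A n z := by
      rcases Nat.eq_zero_or_pos n with h0 | h0
      · subst h0; exact mem_A_zero hz' hV
      · exact h3 h0
    have h1' : n < len z := by
      by_contra hlt
      exact hzz (A_of_len_le hA (by omega)).symm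
    have h2' : n < len z' := by
      by_contra hlt
      exact hzz (A_of_len_le (A_symm hA) (by omega))
    refine ⟨h1', h2', fun _ => mem_A_succ hA hz' ?_⟩
    rw [← tgt_ed hd hz, ← tgt_ed hd hz']
    rw [pt, pt, if_pos h1', if_pos h2'] at hn
    rw [hn]

theorem ed_eq {d : Set G} {n : ℕ} {z z' : G} (h : z' ∈ A n z) {i : ℕ} (hi : i < n) :
    ed d i z' = ed d i z := by
  rw [ed, ed, V_eq (A_mono hi.le h), V_eq (A_mono (Nat.succ_le_of_lt hi) h)]

theorem K_cases {d : Set G} (hd : Good d) {x : ℕ → (graph G).E} (hx : x ∈ K d) (n : ℕ) :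
    (∃ z ∈ d, len z ≤ n ∧ ∃ τ ∈ K {1}, x = pt d z τ) ∨
      ∃ z ∈ d, n ≤ len z ∧ (∀ i < n, x i = ed d i z) ∧ src (x n) = V d n z := by
  induction n with
  | zero =>
    obtain ⟨-, z, hz, h⟩ := hx
    exact Or.inr ⟨z, hz, Nat.zero_le _, by simp, h⟩
  | succ n ih =>
    rcases ih with ⟨z, hz, hn, h⟩ | ⟨z, hz, hn, hpre, hsrc⟩
    · exact Or.inl ⟨z, hz, by omega, h⟩
    rcases hn.eq_or_lt with hn | hn
    · left
      refine ⟨z, hz, by omega, fun i => x (i + n), mem_K_one.2 ⟨fun i => ?_, ?_⟩, ?_⟩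
      · have := hx.1 (i + n)
        rwa [show i + n + 1 = i + 1 + n by omega] at this
      · rw [Nat.zero_add, hsrc, V_of_len_le hz hn.ge]
      · funext i
        by_cases hi : i < len z
        · rw [pt, if_pos hi, hpre i (by omega)]
        · rw [pt, if_neg hi]
          congr 1
          omega
    · right
      have hne : V d n z ≠ {1} := fun h => by
        have := len_le_of_V hz h; omega
      obtain ⟨w, hw, hxn⟩ := edge_cases (x n) (by rwa [hsrc])
      rw [hsrc] at hw hxn
      rw [V_add hw] at hxn
      have hA := hw.2
      have hd' := hw.1
      generalize px n z * w = z' at *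
      have hVz : V d n z' = V d n z := V_eq hA
      have hxn' : x n = ed d n z' := by rw [hxn, ed, hVz]
      refine ⟨z', hd', ?_, ?_, ?_⟩
      · by_contra hlt
        exact hne (by rw [← hVz]; exact V_of_len_le hd' (by omega))
      · intro i hi
        rcases Nat.lt_succ_iff_lt_or_eq.1 hi with hi | rfl
        · rw [hpre i hi, ed_eq hA hi]
        · exact hxn'
      · rw [← mem_shift.1 hx.1, hxn', tgt_ed hd hd']

theorem K_approx {d : Set G} (hd : Good d) {x : ℕ → (graph G).E} (hx : x ∈ K d) (n : ℕ) :
    ∃ z ∈ d, ∃ τ ∈ K {1}, ∀ i < n, x i = pt d z τ i := by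
  rcases K_cases hd hx n with ⟨z, hz, -, τ, hτ, rfl⟩ | ⟨z, hz, hn, hpre, -⟩
  · exact ⟨z, hz, τ, hτ, fun _ _ => rfl⟩
  · refine ⟨z, hz, loopPath false, loopPath_mem _, fun i hi => ?_⟩
    rw [pt, if_pos (by omega), hpre i hi]

/-! ### The maps induced by group elements -/

theorem dst_one_mul (u z : G) : dst 1 (u * z) ≤ len u + len z := by
  have := dst_tri 1 u (u * z)
  have h2 := dst_mul_left u 1 z
  rw [mul_one] at h2
  unfold len; omega

theorem len_inv (u : G) : len u⁻¹ = len u := by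
  unfold len
  rw [dst_comm, ← dst_mul_left u]; simp

theorem len_mul_le (u z : G) : len (u * z) ≤ len u + len z := dst_one_mul u z

theorem len_le_mul (u z : G) : len z ≤ len u + len (u * z) := by
  have := len_mul_le u⁻¹ (u * z)
  rwa [len_inv, inv_mul_cancel_left] at this

theorem contraction_lower {u z : G} {n j : ℕ} {D : ℕ} (hn : n ≤ len z) (hj : j ≤ len (u * z))
    (h : len ((px j (u * z))⁻¹ * (u * px n z)) ≤ D) : n ≤ len u + D + j := by
  have h1 := len_le_mul u (px n z)
  have h2 := len_mul_le (px j (u * z)) ((px j (u * z))⁻¹ * (u * px n z))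
  rw [mul_inv_cancel_left, px_len hj] at h2
  rw [px_len hn] at h1
  omega

theorem pt_uniform {d d' : Set G} (hd : Good d) (u : G) (m : ℕ) : ∃ n, ∀ z ∈ d, ∀ z' ∈ d,
    ∀ τ ∈ K ({1} : Set G), ∀ τ' ∈ K ({1} : Set G),
    (∀ i < n, pt d z τ i = pt d z' τ' i) →
      ∀ i < m, pt d' (u * z) τ i = pt d' (u * z') τ' i := by
  obtain ⟨L, hL⟩ := contraction u
  refine ⟨L + m + len u + (5 * Ctx.δ G + 1), fun z hz z' hz' τ hτ τ' hτ' h i hi => ?_⟩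
  rcases pt_agree hd hz hz' hτ hτ' _ h with rfl | ⟨h1, h2, h3⟩
  · by_cases hi' : i < len (u * z)
    · rw [pt, pt, if_pos hi', if_pos hi']
    · rw [pt, pt, if_neg hi', if_neg hi']
      have hl := len_le_mul u z
      have := h (i - len (u * z) + len z) (by omega)
      rw [pt, pt, if_neg (by omega), if_neg (by omega)] at this
      simpa using this
  · obtain ⟨j, hj, hA, hlen⟩ := hL _ (by omega) z h1
    have hlow := contraction_lower h1 hj hlen
    have hA' := hA z' (h3 (by omega))
    have := A_len hA' hj
    rw [pt, pt, if_pos (by omega), if_pos (by omega), ed_eq hA' (by omega)]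

/-- Uniform continuity on `K d`. -/
def UC (d : Set G) (ψ : (ℕ → (graph G).E) → ℕ → (graph G).E) : Prop :=
  ∀ m, ∃ n, ∀ x ∈ K d, ∀ y ∈ K d, (∀ i < n, x i = y i) → ∀ i < m, ψ x i = ψ y i

/-- `ψ` is the map `K d → K d'` induced by left multiplication by `u`. -/
def Induced (u : G) (d d' : Set G) (ψ : (ℕ → (graph G).E) → ℕ → (graph G).E) : Prop :=
  UC d ψ ∧ (∀ x ∈ K d, ψ x ∈ K d') ∧ ∀ z ∈ d, ∀ τ ∈ K ({1} : Set G), ψ (pt d z τ) = pt d' (u * z) τ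

theorem exists_induced {u : G} {d d' : Set G} (hd : Good d) (hd' : Good d')
    (hu : ∀ z ∈ d, u * z ∈ d') : ∃ ψ, Induced u d d' ψ := by
  choose N hN using fun m => pt_uniform (d' := d') hd u (m + 1)
  have happ : ∀ x n, ∃ zt : G × (ℕ → (graph G).E), x ∈ K d →
      zt.1 ∈ d ∧ zt.2 ∈ K ({1} : Set G) ∧ ∀ i < n, x i = pt d zt.1 zt.2 i := by
    intro x n
    by_cases hx : x ∈ K d
    · obtain ⟨z, hz, τ, hτ, h⟩ := K_approx hd hx n
      exact ⟨(z, τ), fun _ => ⟨hz, hτ, h⟩⟩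
    · exact ⟨(1, loopPath false), fun h => absurd h hx⟩
  choose a ha using happ
  let ψ : (ℕ → (graph G).E) → ℕ → (graph G).E := fun x m =>
    pt d' (u * (a x (N m)).1) (a x (N m)).2 m
  have key : ∀ x ∈ K d, ∀ m, ∀ z ∈ d, ∀ τ ∈ K ({1} : Set G), (∀ i < N m, x i = pt d z τ i) →
      ψ x m = pt d' (u * z) τ m := by
    intro x hx m z hz τ hτ h
    obtain ⟨h1, h2, h3⟩ := ha x (N m) hx
    exact hN m _ h1 z hz _ h2 τ hτ (fun i hi => (h3 i hi).symm.trans (h i hi)) m (by omega)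
  have hsup : ∀ m, ∀ i < m, N i ≤ (Finset.range m).sup N := fun m i hi =>
    Finset.le_sup (Finset.mem_range.2 hi)
  refine ⟨ψ, ?_, ?_, ?_⟩
  · intro m
    refine ⟨(Finset.range m).sup N, fun x hx y hy hxy i hi => ?_⟩
    obtain ⟨h1, h2, h3⟩ := ha y ((Finset.range m).sup N) hy
    have hle := hsup m i hi
    rw [key x hx i _ h1 _ h2 fun k hk => (hxy k (by omega)).trans (h3 k (by omega)),
      key y hy i _ h1 _ h2 fun k hk => h3 k (by omega)]
  · intro x hx
    apply mem_K_of_approx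
    intro m
    obtain ⟨h1, h2, h3⟩ := ha x ((Finset.range m).sup N) hx
    refine ⟨_, pt_mem hd' (hu _ h1) h2, fun i hi => ?_⟩
    have hle := hsup m i hi
    exact key x hx i _ h1 _ h2 fun k hk => h3 k (by omega)
  · intro z hz τ hτ
    funext m
    exact key _ (pt_mem hd hz hτ) m z hz τ hτ fun _ _ => rfl

/-- The map `K d → K d'` induced by left multiplication by `u`. -/
def phi (u : G) (d d' : Set G) : (ℕ → (graph G).E) → ℕ → (graph G).E :=
  if h : ∃ ψ, Induced u d d' ψ then h.choose else id

theorem phi_spec {u : G} {d d' : Set G} (hd : Good d) (hd' : Good d')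
    (hu : ∀ z ∈ d, u * z ∈ d') : Induced u d d' (phi u d d') := by
  have h := exists_induced hd hd' hu
  rw [phi, dif_pos h]
  exact h.choose_spec

theorem UC_ext {d : Set G} (hd : Good d) {ψ ψ' : (ℕ → (graph G).E) → ℕ → (graph G).E}
    (h : UC d ψ) (h' : UC d ψ')
    (hp : ∀ z ∈ d, ∀ τ ∈ K ({1} : Set G), ψ (pt d z τ) = ψ' (pt d z τ)) :
    ∀ x ∈ K d, ψ x = ψ' x := by
  intro x hx
  funext m
  obtain ⟨n, hn⟩ := h (m + 1)
  obtain ⟨n', hn'⟩ := h' (m + 1)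
  obtain ⟨z, hz, τ, hτ, hxz⟩ := K_approx hd hx (n + n')
  rw [hn x hx _ (pt_mem hd hz hτ) (fun i hi => hxz i (by omega)) m (by omega),
    hn' x hx _ (pt_mem hd hz hτ) (fun i hi => hxz i (by omega)) m (by omega), hp z hz τ hτ]

theorem Induced.eq_phi {u : G} {d d' : Set G} (hd : Good d) (hd' : Good d')
    (hu : ∀ z ∈ d, u * z ∈ d') {ψ : (ℕ → (graph G).E) → ℕ → (graph G).E}
    (h : UC d ψ) (hp : ∀ z ∈ d, ∀ τ ∈ K ({1} : Set G), ψ (pt d z τ) = pt d' (u * z) τ) :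
    ∀ x ∈ K d, phi u d d' x = ψ x := by
  obtain ⟨h1, -, h3⟩ := phi_spec hd hd' hu
  exact UC_ext hd h1 h fun z hz τ hτ => by rw [h3 z hz τ hτ, hp z hz τ hτ]

theorem phi_one {d : Set G} (hd : Good d) : ∀ x ∈ K d, phi 1 d d x = x :=
  Induced.eq_phi hd hd (by simp) (ψ := id) (fun m => ⟨m, fun _ _ _ _ h => h⟩) (by simp)

theorem phi_phi {u u' : G} {d d' d'' : Set G} (hd : Good d) (hd' : Good d') (hd'' : Good d'')
    (hu : ∀ z ∈ d, u * z ∈ d') (hu' : ∀ z ∈ d', u' * z ∈ d'') :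
    ∀ x ∈ K d, phi u' d' d'' (phi u d d' x) = phi (u' * u) d d'' x := by
  obtain ⟨h1, h2, h3⟩ := phi_spec hd hd' hu
  obtain ⟨h1', h2', h3'⟩ := phi_spec hd' hd'' hu'
  intro x hx
  refine (Induced.eq_phi hd hd'' (fun z hz => ?_)
    (ψ := fun x => phi u' d' d'' (phi u d d' x)) ?_ ?_ x hx).symm
  · rw [mul_assoc]; exact hu' _ (hu _ hz)
  · intro m
    obtain ⟨n', hn'⟩ := h1' m
    obtain ⟨n, hn⟩ := h1 n'
    exact ⟨n, fun x hx y hy hxy => hn' _ (h2 x hx) _ (h2 y hy) (hn x hx y hy hxy)⟩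
  · intro z hz τ hτ
    rw [h3 z hz τ hτ, h3' _ (hu z hz) τ hτ, mul_assoc]

/-- The first `k` entries of `x`, followed by `ω`. -/
def app (k : ℕ) (x ω : ℕ → (graph G).E) : ℕ → (graph G).E :=
  fun i => if i < k then x i else ω (i - k)

theorem pt_shift {d : Set G} {k : ℕ} {z w : G} (hk : k ≤ len z)
    (hw : w ∈ V d k z) {τ : ℕ → (graph G).E} (x : ℕ → (graph G).E) (hx : ∀ i < k, x i = ed d i z) :
    pt d (px k z * w) τ = app k x (pt (V d k z) w τ) := by
  have hA := hw.2
  have hlen : len (px k z * w) = k + len w := by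
    have h1 := A_len hA hk
    have h2 := dst_px k (px k z * w)
    rw [A_px hA le_rfl] at h2
    have h3 := dst_mul_left (px k z) 1 w
    rw [mul_one] at h3
    unfold len at *
    omega
  funext i
  simp only [pt, app, hlen]
  by_cases hi : i < k
  · rw [if_pos (by omega), if_pos hi, hx i hi, ed_eq hA hi]
  · rw [if_neg hi]
    obtain ⟨j, rfl⟩ := Nat.exists_eq_add_of_le (not_lt.1 hi)
    by_cases hj : j < len w
    · rw [if_pos (by omega), if_pos (by omega), Nat.add_sub_cancel_left, ed, ed, V_add hw, V_add hw,
        add_assoc]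
    · rw [if_neg (by omega), if_neg (by omega)]
      congr 1
      omega

theorem app_phi {d : Set G} (hd : Good d) {k : ℕ} {z : G} (hz : z ∈ d) (hk : k ≤ len z)
    (x : ℕ → (graph G).E) (hx : ∀ i < k, x i = ed d i z) :
    ∀ ω ∈ K (V d k z), phi (px k z) (V d k z) d ω = app k x ω := by
  refine Induced.eq_phi (Or.inr (hd.isVx_V k hz)) hd (fun w hw => hw.1) (ψ := app k x) ?_ ?_
  · intro m
    refine ⟨m, fun ω _ ω' _ h i hi => ?_⟩
    simp only [app]
    split_ifs
    · rfl
    · exact h _ (by omega)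
  · intro w hw τ hτ
    exact (pt_shift hk hw x hx).symm

/-! ### Concatenation of paths -/

/-- The path `x` without its first `n` edges. -/
def drop (n : ℕ) (x : ℕ → (graph G).E) : ℕ → (graph G).E := fun i => x (n + i)

theorem app_of_lt {k : ℕ} {x ω : ℕ → (graph G).E} {i : ℕ} (h : i < k) : app k x ω i = x i :=
  if_pos h

theorem app_add_index (k : ℕ) (x ω : ℕ → (graph G).E) (i : ℕ) : app k x ω (k + i) = ω i := by
  simp [app]

theorem app_app (m j : ℕ) (y y' ω : ℕ → (graph G).E) :
    app m y (app j y' ω) = app (m + j) (app m y y') ω := by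
  funext i
  rcases lt_or_ge i m with h | h
  · rw [app_of_lt h, app_of_lt (by omega), app_of_lt h]
  obtain ⟨i, rfl⟩ := Nat.exists_eq_add_of_le h
  rw [app_add_index]
  rcases lt_or_ge i j with h' | h'
  · rw [app_of_lt h', app_of_lt (by omega), app_add_index]
  obtain ⟨i, rfl⟩ := Nat.exists_eq_add_of_le h'
  rw [app_add_index, ← add_assoc, app_add_index]

theorem app_congr {n : ℕ} {x x' : ℕ → (graph G).E} (h : ∀ i < n, x i = x' i)
    (ω : ℕ → (graph G).E) : app n x ω = app n x' ω := by
  funext i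
  unfold app
  split_ifs with hi
  · exact h i hi
  · rfl

theorem app_drop (n : ℕ) (x : ℕ → (graph G).E) : app n x (drop n x) = x := by
  funext i
  rcases lt_or_ge i n with h | h
  · exact app_of_lt h
  obtain ⟨i, rfl⟩ := Nat.exists_eq_add_of_le h
  rw [app_add_index]; rfl

theorem drop_app (n : ℕ) (x ω : ℕ → (graph G).E) : drop n (app n x ω) = ω :=
  funext fun i => app_add_index n x ω i

theorem drop_mem {x : ℕ → (graph G).E} (hx : x ∈ (graph G).shift) (n : ℕ) :
    drop n x ∈ K (src (x n)) :=
  (mem_K_vx (isVx_src _)).2 ⟨fun i => hx (n + i), rfl⟩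

theorem app_mem_shift {x ω : ℕ → (graph G).E} (hx : x ∈ (graph G).shift) {n : ℕ}
    (hω : ω ∈ K (src (x n))) : app n x ω ∈ (graph G).shift := by
  rw [mem_K_vx (isVx_src _)] at hω
  refine mem_shift.2 fun i => ?_
  rcases lt_or_ge i n with h | h
  · rw [app_of_lt h]
    rcases Nat.lt_or_ge (i + 1) n with h' | h'
    · rw [app_of_lt h']; exact mem_shift.1 hx i
    · obtain rfl : i + 1 = n := by omega
      have := app_add_index (i + 1) x ω 0
      rw [add_zero] at this
      rw [this, hω.2]
      exact mem_shift.1 hx i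
  · obtain ⟨i, rfl⟩ := Nat.exists_eq_add_of_le h
    rw [add_assoc, app_add_index, app_add_index]
    exact mem_shift.1 hω.1 i

theorem src_app {x ω : ℕ → (graph G).E} {n : ℕ} (hω : ω ∈ K (src (x n))) {i : ℕ} (hi : i ≤ n) :
    src (app n x ω i) = src (x i) := by
  rw [mem_K_vx (isVx_src _)] at hω
  rcases hi.lt_or_eq with h | rfl
  · rw [app_of_lt h]
  · have := app_add_index i x ω 0
    rw [add_zero] at this
    rw [this, hω.2]

theorem app_mem {d : Set G} {x ω : ℕ → (graph G).E} (hx : x ∈ K d) {n : ℕ}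
    (hω : ω ∈ K (src (x n))) : app n x ω ∈ K d := by
  refine ⟨app_mem_shift hx.1 hω, ?_⟩
  rw [src_app hω (Nat.zero_le n)]
  exact hx.2

theorem good_src (e : (graph G).E) : Good (src e) := Or.inr (isVx_src e)

/-! ### Contraction -/

/-- The finite set of elements that describe the local actions. -/
def core (G : Type) [Group G] [Ctx G] : Set G := {u | len u ≤ 5 * Ctx.δ G + 1}

theorem one_mem_core : (1 : G) ∈ core G := by
  simp [core, len]

theorem phi_refine {d d' : Set G} (hd : Good d) (hd' : Good d') {u : G}
    (hu : ∀ z ∈ d, u * z ∈ d') (M : ℕ) :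
    ∃ L, ∀ k ≥ L, ∀ x ∈ K d, ∃ j ≥ M, ∃ y ∈ K d', ∃ v ∈ core G,
      (∀ w ∈ src (x k), v * w ∈ src (y j)) ∧ ∀ ω ∈ K (src (x k)),
        phi u d d' (app k x ω) = app j y (phi v (src (x k)) (src (y j)) ω) := by
  obtain ⟨L, hL⟩ := contraction u
  refine ⟨L + M + len u + (5 * Ctx.δ G + 1), fun k hk x hx => ?_⟩
  have hphi := phi_spec hd hd' hu
  rcases K_cases hd hx k with ⟨z, hz, hzk, τ, hτ, rfl⟩ | ⟨z, hz, hn, hpre, hsrc⟩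
  · obtain ⟨i, rfl⟩ := Nat.exists_eq_add_of_le hzk
    have hl := len_le_mul u z
    have e1 : pt d z τ (len z + i) = τ i := by simp [pt]
    have e2 : pt d' (u * z) τ (len (u * z) + i) = τ i := by simp [pt]
    refine ⟨len (u * z) + i, by omega, pt d' (u * z) τ, pt_mem hd' (hu z hz) hτ, 1,
      one_mem_core, ?_, ?_⟩
    · rw [e1, e2]; simp
    · rw [e1, e2]
      intro ω hω
      rw [phi_one (good_src _) ω hω]
      have key : ∀ (d : Set G) (z : G), app (len z + i) (pt d z τ) ω = pt d z (app i τ ω) := by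
        intro d z
        funext j
        rcases lt_or_ge j (len z) with h | h
        · rw [app_of_lt (by omega), pt, pt, if_pos h, if_pos h]
        obtain ⟨j, rfl⟩ := Nat.exists_eq_add_of_le h
        unfold app pt
        simp only [add_lt_add_iff_left, Nat.add_sub_add_left, Nat.add_sub_cancel_left]
        simp
      rw [key, key, hphi.2.2 z hz _ (app_mem hτ hω)]
  · obtain ⟨j, hj, hA, hlen⟩ := hL k (by omega) z hn
    have hlow := contraction_lower hn hj hlen
    have hsy : src (pt d' (u * z) (loopPath false) j) = V d' j (u * z) :=
      src_pt hd' (hu z hz) (loopPath_mem _) hj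
    have hv : ∀ w ∈ V d k z, (px j (u * z))⁻¹ * (u * px k z) * w ∈ V d' j (u * z) := by
      intro w hw
      have h1 := hA _ hw.2
      have h2 := hu _ hw.1
      simp only [V, Set.mem_ofPred_eq, mul_assoc, mul_inv_cancel_left]
      exact ⟨h2, h1⟩
    refine ⟨j, by omega, pt d' (u * z) (loopPath false), pt_mem hd' (hu z hz) (loopPath_mem _),
      (px j (u * z))⁻¹ * (u * px k z), hlen, ?_, ?_⟩
    · rw [hsrc, hsy]; exact hv
    · rw [hsrc, hsy]
      intro ω hω
      have g1 : Good (V d k z) := Or.inr (hd.isVx_V k hz)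
      have g2 : Good (V d' j (u * z)) := Or.inr (hd'.isVx_V j (hu z hz))
      have hpre' : ∀ i < j, pt d' (u * z) (loopPath false) i = ed d' i (u * z) :=
        fun i hi => if_pos (by omega)
      rw [← app_phi hd hz hn x hpre ω hω, phi_phi g1 hd hd' (fun w hw => hw.1) hu ω hω,
        ← app_phi hd' (hu z hz) hj _ hpre' _
          ((phi_spec g1 g2 hv).2.1 ω hω),
        phi_phi g1 g2 hd' hv (fun w hw => hw.1) ω hω, mul_inv_cancel_left]

/-! ### Germs -/

/-- The space on which the group acts. -/
def space (G : Type) [Group G] [Ctx G] : Set (ℕ → (graph G).E) := K Set.univ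

/-- On the paths that start with the first `n` edges of `x`, the map `f` is induced by an
element of `F`, and the image lies in a cone of depth at least `M`. -/
def Germ (F : Set G) (M : ℕ) (f : (ℕ → (graph G).E) → ℕ → (graph G).E) (n : ℕ)
    (x : ℕ → (graph G).E) : Prop :=
  ∃ m ≥ M, ∃ y ∈ space G, ∃ u ∈ F, (∀ w ∈ src (x n), u * w ∈ src (y m)) ∧
    ∀ ω ∈ K (src (x n)), f (app n x ω) = app m y (phi u (src (x n)) (src (y m)) ω)

theorem Germ.refine {f : (ℕ → (graph G).E) → ℕ → (graph G).E} {n : ℕ} {x : ℕ → (graph G).E}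
    (h : Germ Set.univ 0 f n x) (M : ℕ) :
    ∃ L, ∀ k ≥ L, ∀ x' ∈ space G, (∀ i < n, x' i = x i) → src (x' n) = src (x n) →
      Germ (core G) M f (n + k) x' := by
  obtain ⟨m, -, y, hy, u, -, hu, hf⟩ := h
  obtain ⟨L, hL⟩ := phi_refine (good_src _) (good_src _) hu M
  refine ⟨L, fun k hk x' hx' hpre hsrc => ?_⟩
  have hω := drop_mem hx'.1 n
  rw [hsrc] at hω
  obtain ⟨j, hj, y', hy', v, hv, hv', hphi⟩ := hL k hk _ hω
  have e : app m y y' (m + j) = y' j := app_add_index _ _ _ _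
  refine ⟨m + j, by omega, app m y y', app_mem hy hy', v, hv, ?_, ?_⟩
  · rw [e]; exact hv'
  · intro ω hω'
    rw [e, ← app_app]
    change _ = app m y (app j y' (phi v (src (drop n x' k)) _ ω))
    rw [← hphi ω hω', ← hf _ (app_mem hω hω'), app_app, ← app_congr hpre (drop n x'), app_drop]

theorem Germ.mono {F F' : Set G} {M M' : ℕ} {f : (ℕ → (graph G).E) → ℕ → (graph G).E} {n : ℕ}
    {x : ℕ → (graph G).E} (hF : F ⊆ F') (hM : M' ≤ M) (h : Germ F M f n x) : Germ F' M' f n x := by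
  obtain ⟨m, hm, y, hy, u, hu, h⟩ := h
  exact ⟨m, hM.trans hm, y, hy, u, hF hu, h⟩

/-- A germ at every point. -/
def Germy (f : (ℕ → (graph G).E) → ℕ → (graph G).E) : Prop :=
  ∀ x ∈ space G, ∃ n, Germ Set.univ 0 f n x

theorem Germy.deep {f : (ℕ → (graph G).E) → ℕ → (graph G).E} (hf : Germy f)
    {x : ℕ → (graph G).E} (hx : x ∈ space G) (M : ℕ) :
    ∃ L, ∀ k ≥ L, ∀ x' ∈ space G, (∀ i < L, x' i = x i) → Germ (core G) M f k x' := by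
  obtain ⟨n, hn⟩ := hf x hx
  obtain ⟨L, hL⟩ := hn.refine M
  refine ⟨n + L + 1, fun k hk x' hx' h => ?_⟩
  obtain ⟨k, rfl⟩ := Nat.exists_eq_add_of_le (show n ≤ k by omega)
  exact hL k (by omega) x' hx' (fun i hi => h i (by omega)) (by rw [h n (by omega)])

theorem germy_phi (u : G) : Germy (phi u Set.univ (Set.univ : Set G)) := by
  obtain ⟨L, hL⟩ := phi_refine good_univ good_univ (u := u) (fun _ _ => Set.mem_univ _) 0
  intro x hx
  obtain ⟨j, hj, y, hy, v, -, h⟩ := hL L le_rfl x hx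
  exact ⟨L, j, hj, y, hy, v, Set.mem_univ _, h⟩

theorem Germy.comp {f g : (ℕ → (graph G).E) → ℕ → (graph G).E} (hf : Germy f) (hg : Germy g)
    (hg' : ∀ x ∈ space G, g x ∈ space G) : Germy (fun x => f (g x)) := by
  intro x hx
  obtain ⟨L, hL⟩ := hf.deep (hg' x hx) 0
  obtain ⟨N, hN⟩ := hg.deep hx (L + 1)
  obtain ⟨m, hm, y, hy, u, hu, huv, hgx⟩ := hN N le_rfl x hx fun _ _ => rfl
  have hx1 := hgx _ (drop_mem hx.1 N)
  rw [app_drop] at hx1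
  obtain ⟨m', hm', y', hy', u', -, huv', hfx⟩ := hL m (by omega) y hy fun i hi => by
    rw [hx1, app_of_lt (by omega)]
  refine ⟨N, m', Nat.zero_le _, y', hy', u' * u, Set.mem_univ _, fun w hw => ?_, fun ω hω => ?_⟩
  · rw [mul_assoc]; exact huv' _ (huv _ hw)
  · simp only
    rw [hgx ω hω, hfx _ ((phi_spec (good_src _) (good_src _) huv).2.1 ω hω),
      phi_phi (good_src _) (good_src _) (good_src _) huv huv' ω hω]

theorem Germy.congr_local {f : (ℕ → (graph G).E) → ℕ → (graph G).E}
    (h : ∀ x ∈ space G, ∃ g N, Germy g ∧ ∀ x' ∈ space G, (∀ i < N, x' i = x i) → f x' = g x') :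
    Germy f := by
  intro x hx
  obtain ⟨g, N, hg, hgf⟩ := h x hx
  obtain ⟨L, hL⟩ := hg.deep hx 0
  obtain ⟨m, hm, y, hy, u, hu, huv, hgx⟩ := hL (L + N) (by omega) x hx fun _ _ => rfl
  refine ⟨L + N, m, hm, y, hy, u, Set.mem_univ _, huv, fun ω hω => ?_⟩
  rw [hgf _ (app_mem hx hω) fun i hi => app_of_lt (by omega), hgx ω hω]

theorem germy_id : Germy (fun x : ℕ → (graph G).E => x) := by
  intro x hx
  refine ⟨0, 0, le_rfl, x, hx, 1, Set.mem_univ _, by simp, fun ω hω => ?_⟩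
  rw [phi_one (good_src _) ω hω]

theorem exists_A_subset {P : Set G} (hP : IsVx P) (u : G) :
    ∃ M, ∀ w ∈ P, ∀ y ∈ A M (u * w), u⁻¹ * y ∈ P := by
  refine ⟨len u + (4 * Ctx.δ G + 1) + Ctx.δ G + 1, fun w hw y hy => hP.saturated hw ?_⟩
  have h := hc_of_mem_A (len u + (4 * Ctx.δ G + 1)) (by omega) hy
  intro a ha
  have h1 := h (u * a) (by have := len_mul_le u a; unfold len at *; omega)
  have h2 := h u (by unfold len; omega)
  rw [← dst_mul_left u a w, ← dst_mul_left u 1 w, ← dst_mul_left u a, ← dst_mul_left u 1,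
    mul_inv_cancel_left, mul_one]
  omega

theorem Germy.inv {f g : (ℕ → (graph G).E) → ℕ → (graph G).E} (hf : Germy f)
    (hg : ∀ y ∈ space G, g y ∈ space G) (hfg : ∀ y ∈ space G, f (g y) = y)
    (hgf : ∀ x ∈ space G, g (f x) = x) : Germy g := by
  intro y hy
  obtain ⟨n, m, -, y1, hy1, u, -, hu, hfx⟩ := hf _ (hg y hy)
  have hxs := hg y hy
  have hyx := hfg y hy
  generalize g y = x at *
  have hPv := isVx_src (x n)
  have hQv := isVx_src (y1 m)
  have hω := drop_mem hxs.1 n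
  have hyeq := hfx _ hω
  rw [app_drop, hyx] at hyeq
  generalize hPdef : src (x n) = P at *
  generalize src (y1 m) = Q at *
  have hP : Good P := Or.inr hPv
  have hQ : Good Q := Or.inr hQv
  obtain ⟨hUC, hmap, hpt⟩ := phi_spec hP hQ hu
  obtain ⟨M, hM⟩ := exists_A_subset hPv u
  obtain ⟨n0, hn0⟩ := hUC (M + 1)
  obtain ⟨z, hz, τ, hτ, hap⟩ := K_approx hP hω n0
  have hy' := hn0 _ hω _ (pt_mem hP hz hτ) hap
  rw [hpt z hz τ hτ] at hy'
  have hyk : ∀ k, y (m + k) = phi u P Q (drop n x) k := fun k => by rw [hyeq, app_add_index]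
  have hz1 := hu z hz
  obtain ⟨k, hk, hkM, hkA⟩ : ∃ k ≤ len (u * z), k ≤ M ∧ ∀ v ∈ A k (u * z), u⁻¹ * v ∈ P := by
    rcases le_total M (len (u * z)) with h | h
    · exact ⟨M, h, le_rfl, hM z hz⟩
    · refine ⟨_, le_rfl, h, fun v hv => ?_⟩
      rw [A_of_len_le hv le_rfl, inv_mul_cancel_left]
      exact hz
  have hsrc : src (y (m + k)) = V Q k (u * z) := by
    rw [hyk, hy' k (by omega), src_pt hQ hz1 hτ hk]
  have hV : Good (V Q k (u * z)) := Or.inr (hQ.isVx_V k hz1)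
  have hu' : ∀ v ∈ V Q k (u * z), u⁻¹ * px k (u * z) * v ∈ P := fun v hv => by
    rw [mul_assoc]; exact hkA _ hv.2
  refine ⟨m + k, n, Nat.zero_le _, x, hxs, u⁻¹ * px k (u * z), Set.mem_univ _, ?_, ?_⟩
  · rw [hsrc, hPdef]; exact hu'
  · rw [hsrc, hPdef]
    intro ω hω'
    have h1 := (phi_spec hV hP hu').2.1 ω hω'
    have hpre : ∀ i < k, phi u P Q (drop n x) i = ed Q i (u * z) := fun i hi => by
      rw [hy' i (by omega), pt, if_pos (by omega)]
    have h2 := app_phi hQ hz1 hk _ hpre ω hω'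
    have h3 := phi_phi hV hP hQ hu' hu ω hω'
    rw [mul_inv_cancel_left, h2] at h3
    rw [hyeq, ← app_app, ← h3, ← hfx _ h1]
    exact hgf _ (app_mem hxs (by rwa [hPdef]))

/-! ### Topology -/

theorem isOpen_cylinder (n : ℕ) (x : ℕ → (graph G).E) : 
    IsOpen {x' : ℕ → (graph G).E | ∀ i < n, x' i = x i} := by
  have : {x' : ℕ → (graph G).E | ∀ i < n, x' i = x i} =
      ⋂ i ∈ Finset.range n, (fun x' => x' i) ⁻¹' {x i} := by
    ext x'; simp
  rw [this]
  exact isOpen_biInter_finset fun i _ => (isOpen_discrete _).preimage (continuous_apply i)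

theorem exists_cylinder_subset {U : Set (ℕ → (graph G).E)} (hU : IsOpen U) {x : ℕ → (graph G).E}
    (hx : x ∈ U) : ∃ n, ∀ x', (∀ i < n, x' i = x i) → x' ∈ U := by
  obtain ⟨I, u, hu, hIU⟩ := isOpen_pi_iff.1 hU x hx
  refine ⟨I.sup id + 1, fun x' h => hIU fun i hi => ?_⟩
  rw [h i (Nat.lt_succ_of_le (Finset.le_sup (f := id) hi))]
  exact (hu i hi).2

theorem isClosed_K (d : Set G) : IsClosed (K d) := by
  refine isClosed_of_closure_subset fun x hx => mem_K_of_approx fun m => ?_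
  obtain ⟨y, hy, hyK⟩ := mem_closure_iff.1 hx _ (isOpen_cylinder m x) fun _ _ => rfl
  exact ⟨y, hyK, fun i hi => (hy i hi).symm⟩

theorem isCompact_space : IsCompact (space G) := (isClosed_K _).isCompact

theorem Germy.uniform {f : (ℕ → (graph G).E) → ℕ → (graph G).E} (hf : Germy f) :
    ∃ N, ∀ n ≥ N, ∀ x ∈ space G, Germ (core G) 0 f n x := by
  have : ∀ x, ∃ L, x ∈ space G → ∀ k ≥ L, ∀ x' ∈ space G, (∀ i < L, x' i = x i) →
      Germ (core G) 0 f k x' := by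
    intro x
    by_cases hx : x ∈ space G
    · exact (hf.deep hx 0).imp fun _ h _ => h
    · exact ⟨0, fun h => absurd h hx⟩
  choose L hL using this
  obtain ⟨t, ht, hcov⟩ := isCompact_space.elim_nhds_subcover
    (fun x => {x' | ∀ i < L x, x' i = x i}) fun x _ =>
      (isOpen_cylinder (L x) x).mem_nhds fun _ _ => rfl
  refine ⟨t.sup L, fun n hn x hx => ?_⟩
  obtain ⟨x', hx't, hx'⟩ := Set.mem_iUnion₂.1 (hcov hx)
  exact hL x' (ht x' hx't) n ((Finset.le_sup hx't).trans hn) x hx hx'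

/-! ### The group -/

theorem permExt_of_mem (h : Equiv.Perm (space G)) {x : ℕ → (graph G).E} (hx : x ∈ space G) :
    (graph G).permExt (space G) h x = h ⟨x, hx⟩ := dif_pos hx

theorem permExt_mem (h : Equiv.Perm (space G)) {x : ℕ → (graph G).E} (hx : x ∈ space G) :
    (graph G).permExt (space G) h x ∈ space G := by
  rw [permExt_of_mem h hx]; exact (h _).2

theorem permExt_mul (a b : Equiv.Perm (space G)) : (graph G).permExt (space G) (a * b) =
    fun x => (graph G).permExt (space G) a ((graph G).permExt (space G) b x) := by
  funext x
  by_cases hx : x ∈ space G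
  · rw [permExt_of_mem _ hx, permExt_of_mem b hx, permExt_of_mem a (b _).2]; rfl
  · simp [FinDigraph.permExt, FinDigraph.homExt, hx]

theorem permExt_one : (graph G).permExt (space G) 1 = fun x => x := by
  funext x
  simp [FinDigraph.permExt, FinDigraph.homExt]

/-- The group of all permutations that locally look like group elements. -/
def grp (G : Type) [Group G] [Ctx G] : Subgroup (Equiv.Perm (space G)) where
  carrier := {h | Germy ((graph G).permExt (space G) h)}
  one_mem' := by
    rw [Set.mem_ofPred_eq, permExt_one]; exact germy_id
  mul_mem' {a b} ha hb := by
    rw [Set.mem_ofPred_eq, permExt_mul]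
    exact Germy.comp ha hb fun x hx => permExt_mem b hx
  inv_mem' {a} ha := by
    have h : ∀ a b : Equiv.Perm (space G), a * b = 1 → ∀ x,
        (graph G).permExt (space G) a ((graph G).permExt (space G) b x) = x := fun a b hab x => by
      have := congrFun (permExt_mul a b) x
      rw [← this, hab, permExt_one]
    exact Germy.inv ha (fun y hy => permExt_mem _ hy) (fun y _ => h a a⁻¹ (mul_inv_cancel a) y)
      fun y _ => h a⁻¹ a (inv_mul_cancel a) y

theorem mem_grp {h : Equiv.Perm (space G)} :
    h ∈ grp G ↔ Germy ((graph G).permExt (space G) h) := Iff.rfl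

theorem continuous_of_mem_grp {h : Equiv.Perm (space G)} (hh : h ∈ grp G) : Continuous h := by
  refine continuous_induced_rng.2 (continuous_pi fun i => ?_)
  refine ((IsLocallyConstant.iff_exists_open _).2 fun x => ?_).continuous
  obtain ⟨L, hL⟩ := (mem_grp.1 hh).deep x.2 (i + 1)
  obtain ⟨m, hm, y, hy, u, hu, huv, hf⟩ := hL L le_rfl x.1 x.2 fun _ _ => rfl
  refine ⟨Subtype.val ⁻¹' {x' | ∀ i < L + 1, x' i = x.1 i},
    (isOpen_cylinder (L + 1) x.1).preimage continuous_subtype_val, fun _ _ => rfl, ?_⟩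
  have key : ∀ x' : space G, (∀ i < L + 1, x'.1 i = x.1 i) → (h x').1 i = y i := by
    intro x' hx'
    have hd := drop_mem x'.2.1 L
    rw [hx' L (by omega)] at hd
    have := hf _ hd
    rw [← app_congr (fun i hi => hx' i (by omega)), app_drop, permExt_of_mem _ x'.2] at this
    change (h ⟨x'.1, x'.2⟩).1 i = _
    rw [this, app_of_lt (by omega)]
  intro x' hx'
  exact (key x' hx').trans (key x fun _ _ => rfl).symm

theorem isFullOn_grp : (graph G).IsFullOn (space G) (grp G) := by
  intro h _ _ hloc
  refine Germy.congr_local fun x hx => ?_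
  obtain ⟨U, hU, hxU, g, hg, hgU⟩ := hloc ⟨x, hx⟩
  obtain ⟨U', hU', rfl⟩ := isOpen_induced_iff.1 hU
  obtain ⟨n, hn⟩ := exists_cylinder_subset hU' hxU
  refine ⟨_, n, hg, fun x' hx' hxx => ?_⟩
  rw [permExt_of_mem _ hx', permExt_of_mem _ hx', hgU ⟨x', hx'⟩ (hn x' hxx)]

/-! ### Finite paths -/

theorem pathEndAux_eq (l : List (graph G).E) : ∀ (v : (graph G).V) (x : ℕ → (graph G).E),
    x ∈ (graph G).shift → (graph G).o (x 0) = v → (∀ i (h : i < l.length), x i = l.get ⟨i, h⟩) →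
      (graph G).pathEndAux v l = (graph G).o (x l.length) := by
  induction l with
  | nil => intro v x _ h _; exact h.symm
  | cons e l ih =>
    intro v x hx _ hl
    have h0 : x 0 = e := hl 0 (by simp)
    have := ih ((graph G).t e) (fun i => x (i + 1)) (fun i => hx (i + 1)) (by rw [← hx 0, h0])
      fun i hi => hl (i + 1) (by simpa using hi)
    exact this

theorem pathEnd_eq {α : (graph G).FinPath} {x : ℕ → (graph G).E} (hx : x ∈ (graph G).cone α) :
    (graph G).pathEnd α = (graph G).o (x α.edges.length) :=
  pathEndAux_eq _ _ _ hx.1 hx.2.1 hx.2.2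

theorem splice_eq {α β : (graph G).FinPath} {x y : ℕ → (graph G).E}
    (hy : y ∈ (graph G).cone β) :
    (graph G).splice α β x = app β.edges.length y (drop α.edges.length x) := by
  funext i
  unfold FinDigraph.splice app
  split_ifs with h
  · exact (hy.2.2 i h).symm
  · exact congrArg x (add_comm _ _)

theorem catPath_eq {α : (graph G).FinPath} {x : ℕ → (graph G).E} (hx : x ∈ (graph G).cone α)
    (w : ℕ → (graph G).E) : (graph G).catPath α w = app α.edges.length x w := by
  unfold FinDigraph.catPath
  rw [splice_eq hx]
  congr 1
  funext i
  exact congrArg w (zero_add i)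

theorem mem_cone_triv {v : (graph G).V} {x : ℕ → (graph G).E} :
    x ∈ (graph G).cone ((graph G).trivPath v) ↔ x ∈ K v.1 := by
  rw [mem_K_vx v.2]
  constructor
  · rintro ⟨h1, h2, -⟩
    exact ⟨h1, congrArg Subtype.val h2⟩
  · rintro ⟨h1, h2⟩
    exact ⟨h1, Subtype.ext h2, fun i h => absurd h (Nat.not_lt_zero i)⟩

theorem mem_cone {α : (graph G).FinPath} {x : ℕ → (graph G).E} (hx : x ∈ (graph G).cone α)
    {x' : ℕ → (graph G).E} : x' ∈ (graph G).cone α ↔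
      x' ∈ (graph G).shift ∧ src (x' 0) = src (x 0) ∧ ∀ i < α.edges.length, x' i = x i := by
  constructor
  · rintro ⟨h1, h2, h3⟩
    exact ⟨h1, src_inj.2 (h2.trans hx.2.1.symm), fun i hi => (h3 i hi).trans (hx.2.2 i hi).symm⟩
  · rintro ⟨h1, h2, h3⟩
    exact ⟨h1, (src_inj.1 h2).trans hx.2.1, fun i hi => (h3 i hi).trans (hx.2.2 i hi)⟩

theorem src_eq_of_mem_cone {α : (graph G).FinPath} {x x' : ℕ → (graph G).E}
    (hx : x ∈ (graph G).cone α) (hx' : x' ∈ (graph G).cone α) :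
    src (x' α.edges.length) = src (x α.edges.length) :=
  src_inj.2 ((pathEnd_eq hx').symm.trans (pathEnd_eq hx))

theorem app_mem_cone {α : (graph G).FinPath} {x ω : ℕ → (graph G).E}
    (hx : x ∈ (graph G).cone α) (hω : ω ∈ K (src (x α.edges.length))) :
    app α.edges.length x ω ∈ (graph G).cone α :=
  (mem_cone hx).2 ⟨app_mem_shift hx.1 hω, src_app hω (Nat.zero_le _), fun _ h => app_of_lt h⟩

theorem K_nonempty {d : Set G} (hd : Good d) (hne : d.Nonempty) : (K d).Nonempty :=
  ⟨_, pt_mem hd hne.choose_spec (loopPath_mem false)⟩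

theorem exists_extends (l : List (graph G).E) : ∀ v : (graph G).V, (graph G).pathOk v l →
    ∃ x ∈ (graph G).shift, (graph G).o (x 0) = v ∧
      ∀ i (h : i < l.length), x i = l.get ⟨i, h⟩ := by
  induction l with
  | nil =>
    intro v _
    obtain ⟨x, hx⟩ := K_nonempty (Or.inr v.2) v.2.nonempty
    have := mem_cone_triv.2 hx
    exact ⟨x, this.1, this.2.1, this.2.2⟩
  | cons e l ih =>
    rintro v ⟨rfl, hl⟩
    obtain ⟨x, hx, hx0, hxl⟩ := ih _ hl
    refine ⟨app 1 (fun _ => e) x, fun i => ?_, by simp [app], fun i hi => ?_⟩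
    · cases i with
      | zero => simpa [app] using hx0.symm
      | succ i => simpa [app] using hx i
    · cases i with
      | zero => simp [app]
      | succ i => simpa [app] using hxl i (by simpa using hi)

theorem noEmptyCones : (graph G).NoEmptyCones := by
  intro α
  obtain ⟨x, h1, h2, h3⟩ := exists_extends α.edges α.start α.ok
  exact ⟨x, h1, h2, h3⟩

/-! ### Local actions -/

/-- The prefix lengths on which all values of `ψ` on `K P` agree. -/
def agreeSet (P : Set G) (ψ : (ℕ → (graph G).E) → ℕ → (graph G).E) : Set ℕ :=
  {k | ∀ x ∈ K P, ∀ y ∈ K P, ∀ i < k, ψ x i = ψ y i}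

/-- The local action determined by a group element and two types. -/
def act (P Q : Vt G) (u : G) : (graph G).V × ((ℕ → (graph G).E) → ℕ → (graph G).E) :=
  (P, fun w => if w ∈ K P.1 then
    fun i => phi u P.1 Q.1 w (i + sSup (agreeSet P.1 (phi u P.1 Q.1))) else w)

/-- A finite set that contains all local actions at small cones. -/
def nuc (G : Type) [Group G] [Ctx G] :
    Set ((graph G).V × ((ℕ → (graph G).E) → ℕ → (graph G).E)) :=
  (fun p : Vt G × Vt G × G => act p.1 p.2.1 p.2.2) '' (Set.univ ×ˢ Set.univ ×ˢ core G)

theorem finite_nuc : (nuc G).Finite :=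
  (Set.finite_univ.prod (Set.finite_univ.prod (finite_ball _))).image _

theorem mem_agreeSet {P Q : Set G} (hP : IsVx P) (hQ : IsVx Q) {u : G}
    (hu : ∀ z ∈ P, u * z ∈ Q) (k : ℕ) :
    k ∈ agreeSet P (phi u P Q) ↔ k ≤ sSup (agreeSet P (phi u P Q)) := by
  obtain ⟨z, hz⟩ := hP.nonempty
  have hb : BddAbove (agreeSet P (phi u P Q)) := by
    refine ⟨len (u * z), fun k hk => ?_⟩
    by_contra hlt
    have hspec := (phi_spec (Or.inr hP) (Or.inr hQ) hu).2.2 z hz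
    have := hk _ (pt_mem (Or.inr hP) hz (loopPath_mem true)) _
      (pt_mem (Or.inr hP) hz (loopPath_mem false)) (len (u * z)) (by omega)
    rw [hspec _ (loopPath_mem _), hspec _ (loopPath_mem _)] at this
    simp only [pt, lt_irrefl, if_false, Nat.sub_self] at this
    exact loopPath_ne this
  refine ⟨fun h => le_csSup hb h, fun h => ?_⟩
  have h0 : (agreeSet P (phi u P Q)).Nonempty :=
    ⟨0, fun _ _ _ _ _ hi => absurd hi (Nat.not_lt_zero _)⟩
  exact fun x hx y hy i hi => Nat.sSup_mem h0 hb x hx y hy i (hi.trans_le h)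

theorem localAction_mem_nuc {f : (ℕ → (graph G).E) → ℕ → (graph G).E} {α : (graph G).FinPath}
    {x : ℕ → (graph G).E} (hx : x ∈ (graph G).cone α)
    (h : Germ (core G) 0 f α.edges.length x) : (graph G).localAction f α ∈ nuc G := by
  obtain ⟨m, -, y, hy, u, hu, huv, hf⟩ := h
  have hPv := isVx_src (x α.edges.length)
  have hQv := isVx_src (y m)
  refine ⟨(⟨_, hPv⟩, ⟨_, hQv⟩, u), ⟨trivial, trivial, hu⟩, ?_⟩
  have hend : (graph G).pathEnd α = ⟨_, hPv⟩ := pathEnd_eq hx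
  have hbar : (graph G).barLen f α =
      m + sSup (agreeSet (src (x α.edges.length)) (phi u (src (x α.edges.length)) (src (y m)))) := by
    have hset : {n | ∀ x ∈ (graph G).cone α, ∀ y ∈ (graph G).cone α, ∀ i < n, f x i = f y i} =
        Set.Iic (m + sSup (agreeSet (src (x α.edges.length))
          (phi u (src (x α.edges.length)) (src (y m))))) := by
      ext k
      rw [Set.mem_Iic, ← Nat.sub_le_iff_le_add', ← mem_agreeSet hPv hQv huv]
      constructor
      · intro hk ω hω ω' hω' i hi
        have := hk _ (app_mem_cone hx hω) _ (app_mem_cone hx hω') (m + i) (by omega)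
        rwa [hf _ hω, hf _ hω', app_add_index, app_add_index] at this
      · intro hk a ha b hb i hi
        have key : ∀ a ∈ (graph G).cone α, drop α.edges.length a ∈ K (src (x α.edges.length)) ∧
            f a = app m y (phi u (src (x α.edges.length)) (src (y m))
              (drop α.edges.length a)) := by
          intro a ha
          have hd := drop_mem ha.1 α.edges.length
          rw [src_eq_of_mem_cone hx ha] at hd
          refine ⟨hd, ?_⟩
          rw [← hf _ hd, ← app_congr ((mem_cone hx).1 ha).2.2, app_drop]
        rw [(key a ha).2, (key b hb).2]
        rcases lt_or_ge i m with h | h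
        · rw [app_of_lt h, app_of_lt h]
        · obtain ⟨i, rfl⟩ := Nat.exists_eq_add_of_le h
          rw [app_add_index, app_add_index]
          exact hk _ (key a ha).1 _ (key b hb).1 i (by omega)
    rw [FinDigraph.barLen, hset, csSup_Iic]
  unfold FinDigraph.localAction act
  refine Prod.ext hend.symm ?_
  funext w
  have hcone : w ∈ (graph G).cone ((graph G).trivPath ((graph G).pathEnd α)) ↔
      w ∈ K (src (x α.edges.length)) := by
    rw [mem_cone_triv, hend]
  by_cases hw : w ∈ K (src (x α.edges.length))
  · refine (if_pos hw).trans (Eq.trans ?_ (if_pos (hcone.2 hw)).symm)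
    funext i
    rw [catPath_eq hx, hbar, hf w hw, add_comm m, ← add_assoc, add_comm _ m, app_add_index]
  · exact (if_neg hw).trans (if_neg fun h => hw (hcone.1 h)).symm

theorem finite_short (N : ℕ) : {α : (graph G).FinPath | α.edges.length < N}.Finite := by
  refine Set.Finite.of_finite_image (f := fun α => (α.start, α.edges))
    ((Set.finite_univ.prod (List.finite_length_lt (graph G).E N)).subset ?_) ?_
  · rintro _ ⟨α, hα, rfl⟩
    exact ⟨trivial, hα⟩
  · rintro ⟨s, l, h⟩ - ⟨s', l', h'⟩ - heq
    simp only [Prod.mk.injEq] at heq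
    obtain ⟨rfl, rfl⟩ := heq
    rfl

theorem Germy.long {f : (ℕ → (graph G).E) → ℕ → (graph G).E} (hf : Germy f) :
    ∃ N, ∀ α : (graph G).FinPath, (graph G).cone α ⊆ space G → N ≤ α.edges.length →
      (graph G).localAction f α ∈ nuc G := by
  obtain ⟨N, hN⟩ := hf.uniform
  refine ⟨N, fun α hα hlen => ?_⟩
  obtain ⟨x, hx⟩ := noEmptyCones α
  exact localAction_mem_nuc hx (hN _ hlen x (hα hx))

theorem Germy.rationalOn {f : (ℕ → (graph G).E) → ℕ → (graph G).E} (hf : Germy f) :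
    (graph G).RationalOn f (space G) := by
  obtain ⟨N, hN⟩ := hf.long
  refine (finite_nuc.union ((finite_short N).image ((graph G).localAction f))).subset ?_
  rintro _ ⟨α, hα, rfl⟩
  rcases le_or_gt N α.edges.length with h | h
  · exact Or.inl (hN α hα h)
  · exact Or.inr ⟨α, h, rfl⟩

theorem Germy.nucleusOf_subset {f : (ℕ → (graph G).E) → ℕ → (graph G).E} (hf : Germy f) :
    (graph G).nucleusOf f (space G) ⊆ nuc G := by
  obtain ⟨N, hN⟩ := hf.long
  intro p hp
  obtain ⟨α, ⟨hα, rfl⟩, hlen⟩ := hp.exists_notMem_finite (finite_short N)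
  exact hN α hα (not_lt.1 hlen)

theorem finite_groupNucleus : ((graph G).groupNucleus (space G) (grp G)).Finite :=
  finite_nuc.subset (Set.iUnion₂_subset fun _ hg => Germy.nucleusOf_subset hg)

theorem isRatHomeo_of_mem_grp {h : Equiv.Perm (space G)} (hh : h ∈ grp G) :
    (graph G).IsRatHomeo (space G) h :=
  ⟨continuous_of_mem_grp hh, continuous_of_mem_grp ((grp G).inv_mem hh), Germy.rationalOn hh⟩

/-! ### Connectivity of the graph -/

theorem pathOk_ofFn (n : ℕ) : ∀ x ∈ (graph G).shift,
    (graph G).pathOk ((graph G).o (x 0)) (List.ofFn fun i : Fin n => x i) := by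
  induction n with
  | zero => intro x _; simp [FinDigraph.pathOk]
  | succ n ih =>
    intro x hx
    rw [List.ofFn_succ]
    refine ⟨rfl, ?_⟩
    have := ih (fun i => x (i + 1)) fun i => hx (i + 1)
    rw [← hx 0] at this
    exact this

/-- The path formed by the first `n` edges of `x`. -/
def initial (n : ℕ) (x : ℕ → (graph G).E) (hx : x ∈ (graph G).shift) : (graph G).FinPath :=
  ⟨(graph G).o (x 0), List.ofFn fun i : Fin n => x i, pathOk_ofFn n x hx⟩

theorem length_initial (n : ℕ) (x : ℕ → (graph G).E) (hx : x ∈ (graph G).shift) :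
    (initial n x hx).edges.length = n := List.length_ofFn

theorem mem_cone_initial (n : ℕ) (x : ℕ → (graph G).E) (hx : x ∈ (graph G).shift) :
    x ∈ (graph G).cone (initial n x hx) :=
  ⟨hx, rfl, fun i h => by simp [initial]⟩

theorem exists_path (P Q : Vt G) : ∃ x ∈ K P.1, ∃ n > 0, src (x n) = Q.1 := by
  obtain ⟨z, hz⟩ := P.2.nonempty
  obtain ⟨ω, hω⟩ := K_nonempty (Or.inr Q.2) Q.2.nonempty
  have hω' := (mem_K_vx Q.2).1 hω
  have hτ : app 1 (fun _ => outE Q false) ω ∈ K ({1} : Set G) := by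
    refine mem_K_one.2 ⟨mem_shift.2 fun i => ?_, rfl⟩
    cases i with
    | zero => exact hω'.2.symm
    | succ i => simpa [app] using mem_shift.1 hω'.1 i
  refine ⟨_, pt_mem (Or.inr P.2) hz hτ, len z + 1, Nat.succ_pos _, ?_⟩
  simpa [pt, app] using hω'.2

theorem outE_ne (P : Vt G) : outE P true ≠ outE P false := by
  intro h
  have : ((outE P true : Ed G)).1.2.2 = (outE P false : Ed G).1.2.2 :=
    congrArg (fun e : Ed G => e.1.2.2) h
  simp [outE] at this

theorem hasIrreducibleCore : (graph G).HasIrreducibleCore := by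
  refine ⟨Set.univ, ⟨fun v _ w _ => ?_, fun h => ?_⟩,
    fun v => ⟨(graph G).trivPath v, rfl, trivial⟩, 0, fun _ _ => trivial⟩
  · obtain ⟨x, hx, n, hn, h⟩ := exists_path v w
    rw [mem_K_vx v.2] at hx
    refine ⟨initial n x hx.1, Subtype.ext hx.2, ?_, fun h0 => ?_, trivial,
      fun _ _ => ⟨trivial, trivial⟩⟩
    · rw [pathEnd_eq (mem_cone_initial n x hx.1), length_initial]
      exact Subtype.ext h
    · have := length_initial n x hx.1
      rw [h0] at this
      simp only [List.length_nil] at this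
      omega
  · obtain ⟨e, -, he⟩ := h (⟨({1} : Set G), isVx_one⟩ : Vt G) trivial
    let v : Vt G := ⟨{1}, isVx_one⟩
    exact outE_ne v ((he (outE v true) ⟨⟨trivial, trivial⟩, rfl⟩).trans
      (he (outE v false) ⟨⟨trivial, trivial⟩, rfl⟩).symm)

theorem noIsolatedPoints : (graph G).NoIsolatedPoints := by
  intro x hopen
  obtain ⟨U, hU, hUx⟩ := isOpen_induced_iff.1 hopen
  have hxU : x ∈ Subtype.val ⁻¹' U := by rw [hUx]; rfl
  obtain ⟨n, hn⟩ := exists_cylinder_subset hU hxU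
  have hP := isVx_src (x.1 n)
  obtain ⟨z, hz⟩ := hP.nonempty
  have key : ∀ b, pt (src (x.1 n)) z (loopPath b) = drop n x.1 := by
    intro b
    have hω := pt_mem (Or.inr hP) hz (loopPath_mem b)
    have h1 : (⟨_, app_mem_shift x.2 hω⟩ : (graph G).shift) ∈ Subtype.val ⁻¹' U :=
      hn _ fun i hi => app_of_lt hi
    rw [hUx, Set.mem_singleton_iff] at h1
    have h2 := congrArg (fun x => drop n x.1) h1
    simp only [drop_app] at h2
    exact h2
  have := congrFun ((key true).trans (key false).symm) (len z)
  simp only [pt, lt_irrefl, if_false, Nat.sub_self] at this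
  exact loopPath_ne this

theorem clopenIn_space : (graph G).ClopenIn (space G) := by
  refine ⟨(isClosed_K _).preimage continuous_subtype_val,
    isOpen_iff_forall_mem_open.2 fun x hx => ⟨Subtype.val ⁻¹' {x' | ∀ i < 1, x' i = x.1 i}, ?_,
      (isOpen_cylinder 1 x.1).preimage continuous_subtype_val, fun _ _ => rfl⟩⟩
  intro x' hx'
  refine ⟨x'.2, ?_⟩
  rw [hx' 0 Nat.one_pos]
  exact hx.2

/-! ### Canonical similarities -/

theorem cone_subset_space {α : (graph G).FinPath} {x : ℕ → (graph G).E}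
    (hx : x ∈ (graph G).cone α) (hxs : x ∈ space G) : (graph G).cone α ⊆ space G := by
  intro x' hx'
  obtain ⟨h1, h2, -⟩ := (mem_cone hx).1 hx'
  refine ⟨h1, ?_⟩
  rw [h2]
  exact hxs.2

theorem cone_subset_cone {α β : (graph G).FinPath} {x : ℕ → (graph G).E}
    (hα : x ∈ (graph G).cone α) (hβ : x ∈ (graph G).cone β)
    (h : α.edges.length ≤ β.edges.length) : (graph G).cone β ⊆ (graph G).cone α := by
  intro x' hx'
  obtain ⟨h1, h2, h3⟩ := (mem_cone hβ).1 hx'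
  exact (mem_cone hα).2 ⟨h1, h2, fun i hi => h3 i (hi.trans_le h)⟩

theorem src_eq_of_pathEnd_eq {α β : (graph G).FinPath}
    (hend : (graph G).pathEnd α = (graph G).pathEnd β) {x y : ℕ → (graph G).E}
    (hx : x ∈ (graph G).cone α) (hy : y ∈ (graph G).cone β) :
    src (x α.edges.length) = src (y β.edges.length) := by
  rw [src_inj, ← pathEnd_eq hx, ← pathEnd_eq hy, hend]

theorem splice_mem {α β : (graph G).FinPath} (hend : (graph G).pathEnd α = (graph G).pathEnd β)
    {x : ℕ → (graph G).E} (hx : x ∈ (graph G).cone α) :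
    (graph G).splice α β x ∈ (graph G).cone β := by
  obtain ⟨y, hy⟩ := noEmptyCones β
  rw [splice_eq hy]
  refine app_mem_cone hy ?_
  rw [← src_eq_of_pathEnd_eq hend hx hy]
  exact drop_mem hx.1 _

theorem splice_splice (α β γ : (graph G).FinPath) (x : ℕ → (graph G).E) :
    (graph G).splice β γ ((graph G).splice α β x) = (graph G).splice α γ x := by
  obtain ⟨y, hy⟩ := noEmptyCones β
  obtain ⟨w, hw⟩ := noEmptyCones γ
  rw [splice_eq hy, splice_eq hw, splice_eq hw, drop_app]

theorem splice_self {α : (graph G).FinPath} {x : ℕ → (graph G).E}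
    (hx : x ∈ (graph G).cone α) : (graph G).splice α α x = x := by
  rw [splice_eq hx, app_drop]

theorem germ_of_splice {α β : (graph G).FinPath}
    (hend : (graph G).pathEnd α = (graph G).pathEnd β) (hβ : (graph G).cone β ⊆ space G)
    {f : (ℕ → (graph G).E) → ℕ → (graph G).E}
    (hf : ∀ x ∈ (graph G).cone α, f x = (graph G).splice α β x) {x : ℕ → (graph G).E}
    (hx : x ∈ (graph G).cone α) : Germ Set.univ 0 f α.edges.length x := by
  obtain ⟨y, hy⟩ := noEmptyCones β
  refine ⟨β.edges.length, Nat.zero_le _, y, hβ hy, 1, trivial, ?_, ?_⟩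
  · rw [← src_eq_of_pathEnd_eq hend hx hy]; simp
  · rw [← src_eq_of_pathEnd_eq hend hx hy]
    intro ω hω
    rw [hf _ (app_mem_cone hx hω), splice_eq hy, drop_app, phi_one (good_src _) ω hω]

/-- Exchange the cones of `α` and `β`. -/
def swapMap (α β : (graph G).FinPath) (x : ℕ → (graph G).E) : ℕ → (graph G).E :=
  if x ∈ (graph G).cone α then (graph G).splice α β x
  else if x ∈ (graph G).cone β then (graph G).splice β α x else x

theorem exists_swap {α β : (graph G).FinPath}
    (hend : (graph G).pathEnd α = (graph G).pathEnd β) (hα : (graph G).cone α ⊆ space G)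
    (hβ : (graph G).cone β ⊆ space G) (hdis : Disjoint ((graph G).cone α) ((graph G).cone β)) :
    ∃ g ∈ grp G, (graph G).RealizesCanonSim (space G) g α β := by
  have e1 : ∀ x ∈ (graph G).cone α, swapMap α β x = (graph G).splice α β x :=
    fun x hx => if_pos hx
  have e2 : ∀ x ∈ (graph G).cone β, swapMap α β x = (graph G).splice β α x := fun x hx =>
    (if_neg fun h => Set.disjoint_left.1 hdis h hx).trans (if_pos hx)
  have e3 : ∀ x, x ∉ (graph G).cone α → x ∉ (graph G).cone β → swapMap α β x = x :=
    fun x h h' => (if_neg h).trans (if_neg h')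
  have hmem : ∀ x ∈ space G, swapMap α β x ∈ space G ∧ swapMap α β (swapMap α β x) = x := by
    intro x hx
    by_cases h : x ∈ (graph G).cone α
    · have := splice_mem hend h
      rw [e1 x h, e2 _ this, splice_splice, splice_self h]
      exact ⟨hβ this, rfl⟩
    by_cases h' : x ∈ (graph G).cone β
    · have := splice_mem hend.symm h'
      rw [e2 x h', e1 _ this, splice_splice, splice_self h']
      exact ⟨hα this, rfl⟩
    · rw [e3 x h h', e3 x h h']
      exact ⟨hx, rfl⟩
  let g : Equiv.Perm (space G) := Function.Involutive.toPerm
    (fun x => ⟨swapMap α β x.1, (hmem x.1 x.2).1⟩) fun x => Subtype.ext (hmem x.1 x.2).2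
  have hg : ∀ x ∈ space G, (graph G).permExt (space G) g x = swapMap α β x :=
    fun x hx => permExt_of_mem g hx
  refine ⟨g, fun x hx => ?_, fun x hx hxα => e1 x hxα⟩
  by_cases h : x ∈ (graph G).cone α
  · exact ⟨_, germ_of_splice hend hβ (fun x hx => (hg x (hα hx)).trans (e1 x hx)) h⟩
  by_cases h' : x ∈ (graph G).cone β
  · exact ⟨_, germ_of_splice hend.symm hα (fun x hx => (hg x (hβ hx)).trans (e2 x hx)) h'⟩
  set N := α.edges.length + β.edges.length + 1 with hN
  have hout : ∀ γ : (graph G).FinPath, γ.edges.length < N → x ∉ (graph G).cone γ →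
      ∀ x', (∀ i < N, x' i = x i) → x' ∉ (graph G).cone γ := by
    intro γ hγ hxγ x' hx' hc
    exact hxγ ((mem_cone hc).2 ⟨hx.1, by rw [hx' 0 (by omega)], fun i hi =>
      (hx' i (by omega)).symm⟩)
  refine ⟨N, N, Nat.zero_le _, x, hx, 1, trivial, by simp, fun ω hω => ?_⟩
  have hpre : ∀ i < N, app N x ω i = x i := fun i hi => app_of_lt hi
  rw [hg _ (app_mem hx hω), e3 _ (hout α (by omega) h _ hpre) (hout β (by omega) h' _ hpre),
    phi_one (good_src _) ω hω]

theorem exists_disjoint_cone {γ : (graph G).FinPath} (hγ : (graph G).cone γ ⊂ space G)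
    (v : Vt G) : ∃ γ' : (graph G).FinPath, (graph G).pathEnd γ' = v ∧
      (graph G).cone γ' ⊆ space G ∧ Disjoint ((graph G).cone γ') ((graph G).cone γ) := by
  obtain ⟨p, hp, hpγ⟩ := Set.exists_of_ssubset hγ
  set N := γ.edges.length + 1
  obtain ⟨ω, hω, n, -, hn⟩ := exists_path ⟨_, isVx_src (p N)⟩ v
  have hx := app_mem hp hω
  have hc := mem_cone_initial (N + n) _ hx.1
  refine ⟨initial (N + n) _ hx.1, ?_, cone_subset_space hc hx, Set.disjoint_left.2 ?_⟩
  · rw [pathEnd_eq hc, length_initial, app_add_index]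
    exact Subtype.ext hn
  · intro x' hx' hxγ
    have hpre : ∀ i < N, p i = x' i := fun i hi => by
      rw [((mem_cone hc).1 hx').2.2 i (by rw [length_initial]; omega), app_of_lt hi]
    exact hpγ ((mem_cone hxγ).2 ⟨hp.1, by rw [hpre 0 (by omega)],
      fun i hi => hpre i (by omega)⟩)

theorem isRSG_grp : (graph G).IsRSG (space G) (grp G) := by
  refine ⟨fun g hg => isRatHomeo_of_mem_grp hg, fun α β hend hα hβ => ?_⟩
  by_cases hdis : Disjoint ((graph G).cone α) ((graph G).cone β)
  · exact exists_swap hend hα.subset hβ.subset hdis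
  obtain ⟨x, hxα, hxβ⟩ := Set.not_disjoint_iff.1 hdis
  obtain ⟨γ, hγend, hγ, hγα, hγβ⟩ : ∃ γ : (graph G).FinPath,
      (graph G).pathEnd γ = (graph G).pathEnd α ∧ (graph G).cone γ ⊆ space G ∧
        Disjoint ((graph G).cone γ) ((graph G).cone α) ∧
          Disjoint ((graph G).cone γ) ((graph G).cone β) := by
    rcases le_total α.edges.length β.edges.length with h | h
    · obtain ⟨γ, h1, h2, h3⟩ := exists_disjoint_cone hα ((graph G).pathEnd α)
      exact ⟨γ, h1, h2, h3, h3.mono_right (cone_subset_cone hxα hxβ h)⟩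
    · obtain ⟨γ, h1, h2, h3⟩ := exists_disjoint_cone hβ ((graph G).pathEnd α)
      exact ⟨γ, h1, h2, h3.mono_right (cone_subset_cone hxβ hxα h), h3⟩
  obtain ⟨g, hg, hg'⟩ := exists_swap hγend.symm hα.subset hγ hγα.symm
  obtain ⟨k, hk, hk'⟩ := exists_swap (hγend.trans hend) hγ hβ.subset hγβ
  refine ⟨k * g, (grp G).mul_mem hk hg, fun x hx hxα => ?_⟩
  have h1 := hg' x hx hxα
  have h2 := hk' _ (g ⟨x, hx⟩).2 (by rw [h1]; exact splice_mem hγend.symm hxα)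
  exact h2.trans (by rw [h1, splice_splice])

/-! ### The embedding -/

theorem phi_univ_mem (u : G) : ∀ x ∈ space G, phi u Set.univ Set.univ x ∈ space G :=
  (phi_spec good_univ good_univ fun _ _ => Set.mem_univ _).2.1

theorem phi_univ_mul (u v : G) : ∀ x ∈ space G,
    phi u Set.univ Set.univ (phi v Set.univ Set.univ x) = phi (u * v) Set.univ Set.univ x :=
  phi_phi good_univ good_univ good_univ (fun _ _ => Set.mem_univ _) fun _ _ => Set.mem_univ _

/-- The permutation induced by a group element. -/
def perm (u : G) : Equiv.Perm (space G) where
  toFun x := ⟨phi u Set.univ Set.univ x.1, phi_univ_mem u x.1 x.2⟩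
  invFun x := ⟨phi u⁻¹ Set.univ Set.univ x.1, phi_univ_mem u⁻¹ x.1 x.2⟩
  left_inv x := Subtype.ext <| by
    simp only [phi_univ_mul _ _ _ x.2, inv_mul_cancel, phi_one good_univ _ x.2]
  right_inv x := Subtype.ext <| by
    simp only [phi_univ_mul _ _ _ x.2, mul_inv_cancel, phi_one good_univ _ x.2]

theorem perm_mem_grp (u : G) : perm u ∈ grp G :=
  Germy.congr_local fun _ _ => ⟨_, 0, germy_phi u, fun _ hx' _ => permExt_of_mem _ hx'⟩

/-- The homomorphism into the group. -/
def embedding (G : Type) [Group G] [Ctx G] : G →* grp G where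
  toFun u := ⟨perm u, perm_mem_grp u⟩
  map_one' := Subtype.ext <| Equiv.ext fun x => Subtype.ext <| phi_one good_univ x.1 x.2
  map_mul' u v := Subtype.ext <| Equiv.ext fun x => Subtype.ext <|
    (phi_univ_mul u v x.1 x.2).symm

theorem embedding_injective : Function.Injective (embedding G) := by
  refine (injective_iff_map_eq_one _).2 fun u hu => ?_
  have hτ := loopPath_mem (G := G) false
  have h1 : (1 : G) ∈ Set.univ := trivial
  have hp : perm u = 1 := congrArg Subtype.val hu
  have hx : phi u Set.univ Set.univ (pt Set.univ 1 (loopPath false)) =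
      pt Set.univ 1 (loopPath false) :=
    congrArg Subtype.val (Equiv.congr_fun hp ⟨_, pt_mem good_univ h1 hτ⟩)
  rw [(phi_spec good_univ good_univ fun _ _ => Set.mem_univ _).2.2 1 h1 _ hτ, mul_one] at hx
  have h0 := src_pt good_univ (Set.mem_univ u) hτ (Nat.zero_le _)
  rw [hx, pt_one] at h0
  have := len_le_of_V (Set.mem_univ u) h0.symm
  exact (dst_eq_zero.1 (Nat.le_zero.1 this)).symm

end HypCode

theorem SlimTriangles.mono {G : Type} [Group G] {S : Set G} {δ δ' : ℝ} (h : SlimTriangles S δ)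
    (hδ : δ ≤ δ') : SlimTriangles S δ' := by
  intro p q r np nq nr hp hq hr h1 h2 h3 i hi
  obtain ⟨j, hj⟩ := h p q r np nq nr hp hq hr h1 h2 h3 i hi
  exact ⟨j, hj.imp (And.imp_right fun h => h.trans hδ) (And.imp_right fun h => h.trans hδ)⟩

/-- Every hyperbolic group embeds into a full, contracting rational similarity
group. -/
theorem hyperbolic_embeds_in_full_contracting_RSG (G : Type) [Group G]
    (hG : IsHyperbolicGroup G) :
    ∃ Γ : FinDigraph, Γ.NoIsolatedPoints ∧ Γ.NoEmptyCones ∧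
      ∃ E : Set (ℕ → Γ.E), E ⊆ Γ.shift ∧ E.Nonempty ∧ Γ.ClopenIn E ∧
        ∃ H : Subgroup (Equiv.Perm ↥E),
          Γ.IsRSG E H ∧ Γ.IsContracting E H ∧ Γ.IsFullOn E H ∧
          ∃ φ : G →* ↥H, Function.Injective ⇑φ := by
  obtain ⟨S, hS, hgen, δ, hδ, hslim⟩ := hG
  let _ : HypCode.Ctx G := ⟨S, hS, hgen, ⌈δ⌉₊, Nat.ceil_pos.2 hδ, hslim.mono (Nat.le_ceil δ)⟩
  exact ⟨HypCode.graph G, HypCode.noIsolatedPoints, HypCode.noEmptyCones, HypCode.space G,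
    fun _ hx => hx.1, HypCode.K_nonempty HypCode.good_univ ⟨1, trivial⟩, HypCode.clopenIn_space,
    HypCode.grp G, HypCode.isRSG_grp,
    ⟨HypCode.hasIrreducibleCore, HypCode.finite_groupNucleus⟩, HypCode.isFullOn_grp,
    HypCode.embedding G, HypCode.embedding_injective⟩

end
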